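/- arXiv:2307.00564 — 5 statements merged into one kernel-verified Lean document; each statement's English description precedes it below -/
import Mathlib

section
/- For N ≥ 3 and 0 < λ < N, for all x ∈ ℝ^N, ∫_{ℝ^N} |x−y|^{−λ} (1+|y|²)^{−(2N−λ)/2} dy = π^{N/2} Γ((N−λ)/2)/Γ((2N−λ)/2) · (1+|x|²)^{−λ/2}. -/
open MeasureTheory Real

section JapaneseBracket

open Module EuclideanGeometry

variable {E : Type*} [NormedAddCommGroup E] [InnerProductSpace ℝ E]

/-- The inversion centred at `c` of square radius `1 + ‖c‖ ^ 2` rescales `1 + ‖z‖ ^ 2`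
conformally. -/
theorem one_add_norm_sq_inversion {c z : E} {R : ℝ} (hR : R ^ 2 = 1 + ‖c‖ ^ 2) (hz : z ≠ c) :
    1 + ‖inversion c R z‖ ^ 2 = (R / ‖z - c‖) ^ 2 * (1 + ‖z‖ ^ 2) := by
  obtain ⟨u, rfl⟩ : ∃ u, z = u + c := ⟨z - c, by simp⟩
  have hu : ‖u‖ ≠ 0 := by simpa using hz
  simp only [inversion, dist_eq_norm, vsub_eq_sub, vadd_eq_add, add_sub_cancel_right]
  rw [norm_add_sq_real, norm_add_sq_real, norm_smul, real_inner_smul_left, norm_of_nonneg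
    (by positivity), div_pow, hR]
  field_simp
  ring

variable [FiniteDimensional ℝ E] [MeasurableSpace E] [BorelSpace E]

/-- The total mass of a power of the Japanese bracket, obtained by writing the power as a Gamma
integral and integrating the resulting Gaussians. -/
theorem integral_one_add_norm_sq_rpow_neg {s : ℝ} (hs : (finrank ℝ E : ℝ) / 2 < s) :
    ∫ y : E, (1 + ‖y‖ ^ 2) ^ (-s) =
      π ^ ((finrank ℝ E : ℝ) / 2) * Gamma (s - (finrank ℝ E : ℝ) / 2) / Gamma s := by
  set d : ℝ := (finrank ℝ E : ℝ)
  have hs0 : 0 < s := lt_of_le_of_lt (by positivity) hs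
  have hpos (y : E) : 0 < 1 + ‖y‖ ^ 2 := by positivity
  have inner_t (y : E) : ∫ t in Set.Ioi (0 : ℝ), t ^ (s - 1) * exp (-((1 + ‖y‖ ^ 2) * t)) =
      (1 + ‖y‖ ^ 2) ^ (-s) * Gamma s := by
    rw [integral_rpow_mul_exp_neg_mul_Ioi hs0 (hpos y), one_div, inv_rpow (hpos y).le,
      rpow_neg (hpos y).le]
  have inner_y {t : ℝ} (ht : 0 < t) : ∫ y : E, t ^ (s - 1) * exp (-((1 + ‖y‖ ^ 2) * t)) =
      π ^ (d / 2) * (t ^ (s - d / 2 - 1) * exp (-(1 * t))) := by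
    have hsplit (y : E) : t ^ (s - 1) * exp (-((1 + ‖y‖ ^ 2) * t)) =
        t ^ (s - 1) * exp (-(1 * t)) * exp (-t * ‖y‖ ^ 2) := by
      rw [mul_assoc, ← exp_add]
      ring_nf
    simp_rw [hsplit]
    rw [integral_const_mul, GaussianFourier.integral_rexp_neg_mul_sq_norm ht,
      div_rpow pi_pos.le ht.le, show s - d / 2 - 1 = (s - 1) - d / 2 by ring,
      rpow_sub ht (s - 1)]
    ring
  have hint : Integrable (Function.uncurry fun (y : E) (t : ℝ) ↦
      t ^ (s - 1) * exp (-((1 + ‖y‖ ^ 2) * t)))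
      (volume.prod (volume.restrict (Set.Ioi (0 : ℝ)))) := by
    have hmeas : Measurable (Function.uncurry fun (y : E) (t : ℝ) ↦
        t ^ (s - 1) * exp (-((1 + ‖y‖ ^ 2) * t))) := by
      unfold Function.uncurry
      fun_prop
    refine (integrable_prod_iff hmeas.aestronglyMeasurable).2 ⟨.of_forall fun y ↦ ?_, ?_⟩
    · refine .of_integral_ne_zero ?_
      simp only [Function.uncurry_apply_pair]
      rw [inner_t]
      exact (mul_pos (rpow_pos_of_pos (hpos y) _) (Gamma_pos_of_pos hs0)).ne'
    · have hnorm (y : E) : ∫ t in Set.Ioi (0 : ℝ), ‖t ^ (s - 1) * exp (-((1 + ‖y‖ ^ 2) * t))‖ =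
          (1 + ‖y‖ ^ 2) ^ (-(2 * s) / 2) * Gamma s := by
        rw [show -(2 * s) / 2 = -s by ring, ← inner_t]
        refine setIntegral_congr_fun measurableSet_Ioi fun t ht ↦ norm_of_nonneg ?_
        exact mul_nonneg (rpow_nonneg (le_of_lt ht) _) (exp_pos _).le
      simp only [Function.uncurry_apply_pair, hnorm]
      exact (integrable_rpow_neg_one_add_norm_sq (by linarith)).mul_const _
  rw [eq_div_iff (Gamma_pos_of_pos hs0).ne', ← integral_mul_const]
  simp_rw [← inner_t]
  rw [integral_integral_swap hint, setIntegral_congr_fun measurableSet_Ioi fun t ht ↦ inner_y ht,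
    integral_const_mul, integral_rpow_mul_exp_neg_mul_Ioi (by linarith) one_pos]
  simp

/-- Change of variables in an integral along an inversion. -/
theorem integral_eq_integral_inversion [Nontrivial E] (c : E) {R : ℝ} (hR : R ≠ 0) (g : E → ℝ) :
    ∫ y, g y = ∫ z, ((R / ‖z - c‖) ^ 2) ^ finrank ℝ E * g (inversion c R z) := by
  have hmaps : Set.MapsTo (inversion c R) {c}ᶜ {c}ᶜ := fun z hz ↦ by
    simpa [inversion_eq_center hR] using hz
  have himage : inversion c R '' {c}ᶜ = {c}ᶜ :=
    hmaps.image_subset.antisymm fun z hz ↦ ⟨_, hmaps hz, inversion_inversion c hR z⟩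
  have hcompl : (volume : Measure E).restrict {c}ᶜ = volume :=
    Measure.restrict_eq_self_of_ae_mem (by simp [ae_iff])
  have h := integral_image_eq_integral_abs_det_fderiv_smul (volume : Measure E)
    (measurableSet_singleton c).compl
    (fun z hz ↦
      (hasFDerivAt_inversion (R := R) (Set.mem_compl_singleton_iff.1 hz)).hasFDerivWithinAt)
    (inversion_injective c hR).injOn g
  rw [himage, hcompl] at h
  rw [h]
  congr 1 with z
  have hdet : |((ℝ ∙ (z - c))ᗮ.reflection : E →L[ℝ] E).det| = 1 := by
    have := (ℝ ∙ (z - c))ᗮ.det_reflection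
    change |LinearMap.det ((ℝ ∙ (z - c))ᗮ.reflection.toLinearMap)| = 1
    simp [this]
  rw [ContinuousLinearMap.det, ContinuousLinearMap.toLinearMap_smul, LinearMap.det_smul, abs_mul,
    dist_eq_norm, abs_of_nonneg (by positivity)]
  rw [ContinuousLinearMap.det] at hdet
  rw [hdet, mul_one, smul_eq_mul]

/-- The Riesz potential of the conformal power of the Japanese bracket. -/
theorem integral_norm_sub_rpow_mul_one_add_norm_sq_rpow {lam : ℝ} (h0 : 0 < lam)
    (hlt : lam < finrank ℝ E) (x : E) :
    ∫ y : E, ‖x - y‖ ^ (-lam) * (1 + ‖y‖ ^ 2) ^ (-((2 * (finrank ℝ E : ℝ) - lam) / 2)) =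
      π ^ ((finrank ℝ E : ℝ) / 2) * Gamma (((finrank ℝ E : ℝ) - lam) / 2) /
        Gamma ((2 * (finrank ℝ E : ℝ) - lam) / 2) * (1 + ‖x‖ ^ 2) ^ (-(lam / 2)) := by
  have : Nontrivial E := nontrivial_of_finrank_pos (R := ℝ) (by exact_mod_cast h0.trans hlt)
  set s : ℝ := (2 * (finrank ℝ E : ℝ) - lam) / 2 with hs
  have hR0 : 0 < √(1 + ‖x‖ ^ 2) := by positivity
  have hR2 : √(1 + ‖x‖ ^ 2) ^ 2 = 1 + ‖x‖ ^ 2 := sq_sqrt (by positivity)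
  have hRlam : (1 + ‖x‖ ^ 2) ^ (-(lam / 2)) = √(1 + ‖x‖ ^ 2) ^ (-lam) := by
    rw [sqrt_eq_rpow, ← rpow_mul (by positivity)]
    ring_nf
  rw [show ((finrank ℝ E : ℝ) - lam) / 2 = s - (finrank ℝ E : ℝ) / 2 by rw [hs]; ring,
    ← integral_one_add_norm_sq_rpow_neg (by linarith), hRlam, ← integral_mul_const,
    integral_eq_integral_inversion x hR0.ne']
  refine integral_congr_ae ?_
  filter_upwards [compl_mem_ae_iff.2 (measure_singleton x)] with z hz
  have hz' : z ≠ x := hz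
  have hn : 0 < ‖z - x‖ := norm_pos_iff.2 (sub_ne_zero.2 hz')
  set R := √(1 + ‖x‖ ^ 2)
  have hq : 0 < R / ‖z - x‖ := by positivity
  rw [one_add_norm_sq_inversion hR2 hz', ← dist_eq_norm x, dist_center_inversion, dist_comm x,
    dist_eq_norm, mul_rpow (by positivity) (by positivity),
    show R ^ 2 / ‖z - x‖ = R / ‖z - x‖ * R by ring, mul_rpow hq.le hR0.le,
    ← rpow_natCast (R / ‖z - x‖), ← rpow_natCast _ (finrank ℝ E), ← rpow_mul hq.le,
    ← rpow_mul hq.le]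
  have hcancel : (R / ‖z - x‖) ^ (((2 : ℕ) : ℝ) * (finrank ℝ E : ℝ)) *
      ((R / ‖z - x‖) ^ (-lam) * (R / ‖z - x‖) ^ (((2 : ℕ) : ℝ) * -s)) = 1 := by
    rw [← rpow_add hq, ← rpow_add hq, ← rpow_zero (R / ‖z - x‖)]
    congr 1
    rw [hs]
    push_cast
    ring
  linear_combination ((1 + ‖z‖ ^ 2) ^ (-s) * R ^ (-lam)) * hcancel

end JapaneseBracket

theorem stmt1 (N : ℕ) (hN : 3 ≤ N) (lam : ℝ) (h0 : 0 < lam) (hlt : lam < N) :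
    ∀ x : EuclideanSpace ℝ (Fin N),
      (∫ y : EuclideanSpace ℝ (Fin N),
          ‖x - y‖ ^ (-lam) * (1 + ‖y‖ ^ 2) ^ (-((2 * (N : ℝ) - lam) / 2)))
        = π ^ ((N : ℝ) / 2) * Gamma (((N : ℝ) - lam) / 2) / Gamma ((2 * (N : ℝ) - lam) / 2)
            * (1 + ‖x‖ ^ 2) ^ (-(lam / 2)) := by
  intro x
  simpa using integral_norm_sub_rpow_mul_one_add_norm_sq_rpow h0 (by simpa using hlt) x
end

section
/- For N ≥ 3, 0 < λ < N, p = (2N−λ)/(N−2), μ > 0, ξ ∈ ℝ^N, the Riesz potential of U_{μ,ξ}^p satisfies ∫_{ℝ^N} U_{μ,ξ}(y)^p |x−y|^{−λ} dy = π^{N/2} Γ((N−λ)/2)/Γ((2N−λ)/2) · U_{μ,ξ}(x)^{λ/(N−2)} for all x ∈ ℝ^N. -/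
open MeasureTheory Real

section

variable {E : Type*} [NormedAddCommGroup E] [InnerProductSpace ℝ E] [FiniteDimensional ℝ E]
  [MeasurableSpace E] [BorelSpace E]

open Module in
/-- The integral of `(c + a ‖v‖ ^ 2) ^ (-s)` over a Euclidean space. -/
theorem integral_add_mul_norm_sq_rpow_neg {a c s : ℝ} (ha : 0 < a) (hc : 0 < c)
    (hs : (finrank ℝ E : ℝ) / 2 < s) :
    ∫ v : E, (c + a * ‖v‖ ^ 2) ^ (-s) =
      π ^ ((finrank ℝ E : ℝ) / 2) * Gamma (s - finrank ℝ E / 2) / Gamma s *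
        (a ^ (-((finrank ℝ E : ℝ) / 2)) * c ^ ((finrank ℝ E : ℝ) / 2 - s)) := by
  set d : ℝ := (finrank ℝ E : ℝ) / 2 with hd
  have hd0 : 0 ≤ d := by positivity
  have hs0 : 0 < s := hd0.trans_lt hs
  have hΓ := Gamma_pos_of_pos hs0
  have hΓd := Gamma_pos_of_pos (sub_pos.2 hs)
  let F : ℝ → E → ℝ := fun t v ↦ t ^ (s - 1) * exp (-((c + a * ‖v‖ ^ 2) * t))
  have hinner : ∀ t ∈ Set.Ioi (0 : ℝ), ∫ v, F t v =
      (π / a) ^ d * (t ^ (s - d - 1) * exp (-(c * t))) := by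
    intro t (ht : 0 < t)
    have h : ∀ v : E, F t v = (t ^ (s - 1) * exp (-(c * t))) * exp (-(a * t) * ‖v‖ ^ 2) := by
      intro v
      simp only [F]
      rw [mul_assoc, ← exp_add]
      ring_nf
    simp_rw [h]
    rw [integral_const_mul, GaussianFourier.integral_rexp_neg_mul_sq_norm (by positivity), ← hd,
      ← div_div, div_rpow (by positivity) ht.le, show s - d - 1 = (s - 1) - d by ring,
      rpow_sub ht (s - 1) d]
    generalize t ^ (s - 1) = u
    ring
  have hgamma : ∫ t in Set.Ioi (0 : ℝ), t ^ (s - d - 1) * exp (-(c * t)) =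
      (1 / c) ^ (s - d) * Gamma (s - d) :=
    integral_rpow_mul_exp_neg_mul_Ioi (sub_pos.2 hs) hc
  have hint : Integrable (Function.uncurry F)
      ((volume.restrict (Set.Ioi (0 : ℝ))).prod (volume : Measure E)) := by
    have hmeas : Measurable (Function.uncurry F) := by
      unfold F Function.uncurry
      fun_prop
    rw [integrable_prod_iff hmeas.aestronglyMeasurable]
    constructor
    · refine (ae_restrict_iff' measurableSet_Ioi).2 (ae_of_all _ fun t (ht : 0 < t) ↦ ?_)
      refine Integrable.of_integral_ne_zero ?_
      simp only [Function.uncurry]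
      rw [hinner t ht]
      positivity
    · have : Integrable (fun t ↦ (π / a) ^ d * (t ^ (s - d - 1) * exp (-(c * t))))
          (volume.restrict (Set.Ioi (0 : ℝ))) := by
        refine Integrable.const_mul (Integrable.of_integral_ne_zero ?_) _
        rw [hgamma]
        positivity
      refine this.congr ((ae_restrict_iff' measurableSet_Ioi).2
        (ae_of_all _ fun t (ht : 0 < t) ↦ ?_))
      simp only [Function.uncurry]
      rw [← hinner t ht]
      refine integral_congr_ae (ae_of_all _ fun v ↦ ?_)
      simp only [F]
      rw [norm_of_nonneg (by positivity)]
  have hswap := integral_integral_swap hint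
  rw [setIntegral_congr_fun measurableSet_Ioi hinner, integral_const_mul, hgamma] at hswap
  have houter : ∀ v : E, ∫ t in Set.Ioi (0 : ℝ), F t v =
      (c + a * ‖v‖ ^ 2) ^ (-s) * Gamma s := by
    intro v
    have hv : 0 < c + a * ‖v‖ ^ 2 := by positivity
    simp only [F]
    rw [integral_rpow_mul_exp_neg_mul_Ioi hs0 hv, one_div, inv_rpow hv.le, rpow_neg hv.le]
  simp_rw [houter] at hswap
  rw [integral_mul_const] at hswap
  rw [← mul_left_inj' hΓ.ne', ← hswap, div_rpow pi_pos.le ha.le, one_div, inv_rpow hc.le,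
    ← rpow_neg hc.le, neg_sub, rpow_neg ha.le]
  field_simp

open Module EuclideanGeometry in
/-- Change of variables under the inversion in the unit sphere centred at `c`. -/
theorem integral_comp_inversion [Nontrivial E] (c : E) (f : E → ℝ) :
    ∫ y, f y = ∫ w, (dist w c ^ (2 * finrank ℝ E))⁻¹ * f (inversion c 1 w) := by
  have himage : inversion c (1 : ℝ) '' {c}ᶜ = {c}ᶜ := by
    rw [Set.image_compl_eq (inversion_bijective c one_ne_zero), Set.image_singleton,
      inversion_self]
  have h := integral_image_eq_integral_abs_det_fderiv_smul (volume : Measure E)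
    (measurableSet_singleton c).compl
    (fun w hw ↦ (hasFDerivAt_inversion (R := 1) (Set.mem_compl_singleton_iff.1 hw)).hasFDerivWithinAt)
    (inversion_injective c one_ne_zero).injOn f
  rw [himage, restrict_compl_singleton c] at h
  rw [h]
  refine integral_congr_ae (ae_of_all _ fun w ↦ ?_)
  have hdet : ((ℝ ∙ (w - c))ᗮ.reflection : E →L[ℝ] E).det =
      (-1) ^ finrank ℝ ((ℝ ∙ (w - c))ᗮᗮ : Submodule ℝ E) :=
    Submodule.det_reflection _
  have hdet' : ((1 / dist w c) ^ 2 • ((ℝ ∙ (w - c))ᗮ.reflection : E →L[ℝ] E)).det =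
      ((1 / dist w c) ^ 2) ^ finrank ℝ E * ((ℝ ∙ (w - c))ᗮ.reflection : E →L[ℝ] E).det :=
    LinearMap.det_smul _ _
  simp only [smul_eq_mul]
  rw [hdet', hdet, abs_mul, abs_pow (-1 : ℝ), abs_neg, abs_one, one_pow, mul_one,
    abs_of_nonneg (by positivity), ← pow_mul, one_div, inv_pow]

open Module EuclideanGeometry in
/-- The Riesz potential of a bubble with conformal exponent is again a power of the bubble. -/
theorem integral_bubble_mul_riesz_kernel [Nontrivial E] {b lam : ℝ} (hb : 0 < b)
    (hlam : lam < finrank ℝ E) (x ξ : E) :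
    ∫ y : E, (1 + b * ‖y - ξ‖ ^ 2) ^ (-((2 * (finrank ℝ E : ℝ) - lam) / 2)) * ‖x - y‖ ^ (-lam) =
      π ^ ((finrank ℝ E : ℝ) / 2) * Gamma ((finrank ℝ E - lam) / 2) /
          Gamma ((2 * (finrank ℝ E : ℝ) - lam) / 2) *
        (b ^ (-((finrank ℝ E - lam) / 2)) * (1 + b * ‖x - ξ‖ ^ 2) ^ (-(lam / 2))) := by
  set n := finrank ℝ E with hn
  set X := x - ξ with hX
  set A := 1 + b * ‖X‖ ^ 2 with hA
  have hA0 : 0 < A := by positivity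
  set s := (2 * (n : ℝ) - lam) / 2 with hs
  have hbA : 0 < b / A := by positivity
  rw [integral_comp_inversion x, ← integral_add_left_eq_self _ x]
  have key : ∀ᵐ v : E, (dist (x + v) x ^ (2 * n))⁻¹ *
      ((1 + b * ‖inversion x 1 (x + v) - ξ‖ ^ 2) ^ (-s) *
        ‖x - inversion x 1 (x + v)‖ ^ (-lam)) =
      (b / A + A * ‖(b / A) • X + v‖ ^ 2) ^ (-s) := by
    filter_upwards [Measure.ae_ne volume (0 : E)] with v hv
    have hr : 0 < ‖v‖ := norm_pos_iff.2 hv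
    have hdist : dist (x + v) x = ‖v‖ := by simp
    have h1 : ‖x - inversion x 1 (x + v)‖ = ‖v‖⁻¹ := by
      rw [← dist_eq_norm, dist_center_inversion, dist_comm, hdist]
      simp
    have h2 : inversion x 1 (x + v) - ξ = X + (‖v‖⁻¹ ^ 2) • v := by
      simp only [inversion, hdist, vsub_eq_sub, vadd_eq_add, add_sub_cancel_left, one_div, hX]
      abel
    have h3 : 1 + b * ‖X + (‖v‖⁻¹ ^ 2) • v‖ ^ 2 =
        (b / A + A * ‖(b / A) • X + v‖ ^ 2) * (‖v‖ ^ 2)⁻¹ := by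
      rw [norm_add_sq_real, norm_add_sq_real, inner_smul_left, inner_smul_right, norm_smul,
        norm_smul, norm_of_nonneg hbA.le, norm_of_nonneg (by positivity)]
      simp only [conj_trivial]
      field_simp
      rw [hA]
      ring
    have hQ : 0 < b / A + A * ‖(b / A) • X + v‖ ^ 2 := by positivity
    rw [hdist, h1, h2, h3, mul_rpow hQ.le (by positivity), inv_rpow (by positivity),
      inv_rpow hr.le, rpow_neg hQ.le, rpow_neg (by positivity) s, rpow_neg hr.le lam, inv_inv, inv_inv,
      ← rpow_natCast ‖v‖ 2, ← rpow_mul hr.le, ← rpow_natCast ‖v‖ (2 * n), mul_assoc, ← rpow_add hr]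
    have he : ((2 : ℕ) : ℝ) * s + lam = ((2 * n : ℕ) : ℝ) := by
      push_cast
      rw [hs]
      ring
    rw [he]
    have : ‖v‖ ^ ((2 * n : ℕ) : ℝ) ≠ 0 := (rpow_pos_of_pos hr _).ne'
    field_simp
  rw [integral_congr_ae key,
    integral_add_left_eq_self (fun v : E ↦ (b / A + A * ‖v‖ ^ 2) ^ (-s)) ((b / A) • X),
    integral_add_mul_norm_sq_rpow_neg hA0 hbA (by rw [hs, ← hn]; linarith), ← hn,
    div_rpow hb.le hA0.le, show s - (n : ℝ) / 2 = (n - lam) / 2 by rw [hs]; ring,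
    show (n : ℝ) / 2 - s = -((n - lam) / 2) by rw [hs]; ring,
    show -(lam / 2) = -((n : ℝ) / 2) - -((n - lam) / 2) by ring, rpow_sub hA0]
  ring

end

theorem stmt11 (N : ℕ) (hN : 3 ≤ N) (lam : ℝ) (h0 : 0 < lam) (hlt : lam < N)
    (μ : ℝ) (hμ : 0 < μ) (ξ : EuclideanSpace ℝ (Fin N)) :
    ∀ x : EuclideanSpace ℝ (Fin N),
      (∫ y : EuclideanSpace ℝ (Fin N),
          (μ ^ (-(((N : ℝ) - 2) / 2)) *
              (1 + ‖y - ξ‖ ^ 2 / μ ^ 2) ^ (-(((N : ℝ) - 2) / 2)))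
            ^ ((2 * (N : ℝ) - lam) / ((N : ℝ) - 2)) * ‖x - y‖ ^ (-lam))
        = π ^ ((N : ℝ) / 2) * Gamma (((N : ℝ) - lam) / 2) /
            Gamma ((2 * (N : ℝ) - lam) / 2) *
          (μ ^ (-(((N : ℝ) - 2) / 2)) *
              (1 + ‖x - ξ‖ ^ 2 / μ ^ 2) ^ (-(((N : ℝ) - 2) / 2)))
            ^ (lam / ((N : ℝ) - 2)) := by
  intro x
  have hN' : (3 : ℝ) ≤ N := by exact_mod_cast hN
  have hN2 : (N : ℝ) - 2 ≠ 0 := by linarith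
  have : NeZero N := ⟨by omega⟩
  have hbubble : ∀ (z : EuclideanSpace ℝ (Fin N)) (q : ℝ),
      (μ ^ (-(((N : ℝ) - 2) / 2)) * (1 + ‖z - ξ‖ ^ 2 / μ ^ 2) ^ (-(((N : ℝ) - 2) / 2)))
        ^ (q / ((N : ℝ) - 2)) =
      μ ^ (-(q / 2)) * (1 + (μ ^ 2)⁻¹ * ‖z - ξ‖ ^ 2) ^ (-(q / 2)) := by
    intro z q
    have he : -(((N : ℝ) - 2) / 2) * (q / ((N : ℝ) - 2)) = -(q / 2) := by field_simp
    rw [mul_rpow (by positivity) (by positivity), ← rpow_mul hμ.le, ← rpow_mul (by positivity), he,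
      div_eq_inv_mul _ (μ ^ 2)]
  have hriesz := integral_bubble_mul_riesz_kernel (E := EuclideanSpace ℝ (Fin N)) (lam := lam)
    (inv_pos.2 (pow_pos hμ 2)) (by simpa using hlt) x ξ
  rw [finrank_euclideanSpace_fin] at hriesz
  simp_rw [hbubble, mul_assoc (μ ^ (-((2 * (N : ℝ) - lam) / 2)))]
  rw [integral_const_mul, hriesz]
  have hpow : ((μ ^ 2)⁻¹ : ℝ) ^ (-(((N : ℝ) - lam) / 2)) = μ ^ ((N : ℝ) - lam) := by
    rw [inv_rpow (by positivity), rpow_neg (by positivity), inv_inv, ← rpow_natCast _ 2,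
      ← rpow_mul hμ.le]
    congr 1
    push_cast
    ring
  rw [hpow, show -(lam / 2) = -((2 * (N : ℝ) - lam) / 2) + (N - lam) by ring, rpow_add hμ]
  ring
end

section
/- For N ≥ 3, 0 < λ < N, λ ≤ 4, p = (2N−λ)/(N−2), and α = N(N−2)Γ(N−λ/2)/(π^{N/2} Γ((N−λ)/2)), the function U(x) = (1+|x|²)^{−(N−2)/2} solves −ΔU(x) = α (∫_{ℝ^N} U(y)^p |x−y|^{−λ} dy) U(x)^{p−1} for all x ∈ ℝ^N. -/
open MeasureTheory Real

/-- The Laplacian of a function on `ℝ^N`. -/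
noncomputable def laplacian {N : ℕ} (f : EuclideanSpace ℝ (Fin N) → ℝ)
    (x : EuclideanSpace ℝ (Fin N)) : ℝ :=
  ∑ i : Fin N,
    iteratedFDeriv ℝ 2 f x ![EuclideanSpace.single i 1, EuclideanSpace.single i 1]


lemma iteratedFDeriv_two_one_add_norm_sq_rpow {E : Type*} [NormedAddCommGroup E]
    [InnerProductSpace ℝ E] (b : ℝ) (x v : E) :
    iteratedFDeriv ℝ 2 (fun y : E => (1 + ‖y‖ ^ 2) ^ (-b)) x ![v, v]
      = -(2 * b) * ((1 + ‖x‖ ^ 2) ^ (-b - 1) * ‖v‖ ^ 2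
          - 2 * (b + 1) * (1 + ‖x‖ ^ 2) ^ (-b - 2) * (inner ℝ x v) ^ 2) := by
  have hpos : ∀ y : E, (1 + ‖y‖ ^ 2) ≠ 0 := fun y => by positivity
  have hd : ∀ (c : ℝ) (y : E), HasFDerivAt (fun y : E => (1 + ‖y‖ ^ 2) ^ c)
      ((c * (1 + ‖y‖ ^ 2) ^ (c - 1)) • ((2 : ℝ) • innerSL ℝ y)) y := by
    intro c y
    have h1 : HasFDerivAt (fun y : E => 1 + ‖y‖ ^ 2) ((2 : ℝ) • innerSL ℝ y) y := by
      simpa [two_smul] using ((hasStrictFDerivAt_norm_sq y).hasFDerivAt).const_add 1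
    exact h1.rpow_const (Or.inl (hpos y))
  have hf : fderiv ℝ (fun y : E => (1 + ‖y‖ ^ 2) ^ (-b))
      = fun y => (1 + ‖y‖ ^ 2) ^ (-b - 1) • ((-(2 * b)) • innerSL ℝ y) := by
    funext y
    rw [(hd (-b) y).fderiv, smul_smul, smul_smul]
    congr 1
    ring
  rw [iteratedFDeriv_two_apply, hf]
  have h2 := (hd (-b - 1) x).fun_smul
    (((innerSL ℝ (E := E)).hasFDerivAt (x := x)).fun_const_smul (-(2 * b)))
  rw [h2.fderiv]
  have e : -b - 1 - 1 = -b - 2 := by ring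
  have hi : ∀ w : E, innerSL ℝ w v = inner ℝ w v := fun _ => rfl
  simp only [e, Matrix.cons_val_zero, Matrix.cons_val_one, add_apply, smul_apply,
    ContinuousLinearMap.smulRight_apply, smul_eq_mul, hi, real_inner_self_eq_norm_sq]
  ring

lemma neg_laplacian_one_add_norm_sq_rpow {N : ℕ} (x : EuclideanSpace ℝ (Fin N)) :
    -laplacian (fun y => (1 + ‖y‖ ^ 2) ^ (-(((N : ℝ) - 2) / 2))) x
      = N * ((N : ℝ) - 2) * (1 + ‖x‖ ^ 2) ^ (-(((N : ℝ) + 2) / 2)) := by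
  have hq : 0 < 1 + ‖x‖ ^ 2 := by positivity
  unfold laplacian
  simp only [iteratedFDeriv_two_one_add_norm_sq_rpow, PiLp.norm_single,
    EuclideanSpace.inner_single_right]
  rw [← Finset.mul_sum, Finset.sum_sub_distrib, ← Finset.mul_sum, ← Finset.mul_sum]
  have hs : ∑ i, (1 * (starRingEnd ℝ) (x.ofLp i)) ^ 2 = ‖x‖ ^ 2 := by
    simp [EuclideanSpace.norm_sq_eq]
  have e1 : (1 + ‖x‖ ^ 2) ^ (-(((N : ℝ) - 2) / 2) - 1)
      = (1 + ‖x‖ ^ 2) ^ (-(((N : ℝ) + 2) / 2)) * (1 + ‖x‖ ^ 2) := by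
    rw [← rpow_add_one hq.ne']
    congr 1
    ring
  have e2 : -(((N : ℝ) - 2) / 2) - 2 = -(((N : ℝ) + 2) / 2) := by ring
  rw [hs, e1, e2]
  simp
  ring

lemma lintegral_rpow_mul_exp_neg_mul_Ioi {c k : ℝ} (hc : 0 < c) (hk : 0 < k) :
    ∫⁻ t in Set.Ioi (0 : ℝ), ENNReal.ofReal (t ^ (c - 1) * exp (-(k * t)))
      = ENNReal.ofReal (Gamma c * k ^ (-c)) := by
  have h := integral_rpow_mul_exp_neg_mul_Ioi hc hk
  have hpos : 0 < (1 / k) ^ c * Gamma c := by have := Gamma_pos_of_pos hc; positivity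
  rw [← ofReal_integral_eq_lintegral_ofReal, h, one_div, inv_rpow hk.le, rpow_neg hk.le, mul_comm]
  · by_contra hi
    rw [integral_undef hi] at h
    exact hpos.ne h
  · filter_upwards [ae_restrict_mem measurableSet_Ioi] with t ht
    have : 0 < t := ht
    positivity

lemma lintegral_exp_neg_mul_norm_sq_add {E : Type*} [NormedAddCommGroup E]
    [InnerProductSpace ℝ E] [FiniteDimensional ℝ E] [MeasurableSpace E] [BorelSpace E]
    (x : E) {u r : ℝ} (hu : 0 < u) (hr : 0 < r) :
    ∫⁻ y : E, ENNReal.ofReal (exp (-(u * (‖y‖ ^ 2 + r * ‖x - y‖ ^ 2))))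
      = ENNReal.ofReal ((π / (u * (1 + r))) ^ ((Module.finrank ℝ E : ℝ) / 2)
          * exp (-(u * (r / (1 + r) * ‖x‖ ^ 2)))) := by
  have hk : 0 < u * (1 + r) := by positivity
  have key : ∀ y : E, exp (-(u * (‖y‖ ^ 2 + r * ‖x - y‖ ^ 2)))
      = exp (-(u * (1 + r)) * ‖y - (r / (1 + r)) • x‖ ^ 2)
        * exp (-(u * (r / (1 + r) * ‖x‖ ^ 2))) := by
    intro y
    rw [← exp_add]
    congr 1
    rw [norm_sub_sq_real, norm_sub_sq_real, norm_smul, real_inner_smul_right,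
      real_inner_comm x y, mul_pow, norm_eq_abs, sq_abs]
    field_simp
    ring
  have hg := GaussianFourier.integral_rexp_neg_mul_sq_norm (V := E) hk
  have hpos : 0 < (π / (u * (1 + r))) ^ ((Module.finrank ℝ E : ℝ) / 2) := by positivity
  have hgi : Integrable fun y : E => exp (-(u * (1 + r)) * ‖y‖ ^ 2) := by
    by_contra hi
    rw [integral_undef hi] at hg
    exact hpos.ne hg
  simp_rw [key, ENNReal.ofReal_mul (exp_pos _).le]
  rw [lintegral_mul_const' _ _ ENNReal.ofReal_ne_top,
    lintegral_sub_right_eq_self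
      (fun y : E => ENNReal.ofReal (exp (-(u * (1 + r)) * ‖y‖ ^ 2))),
    ← ofReal_integral_eq_lintegral_ofReal hgi (ae_of_all _ fun _ => (exp_pos _).le), hg,
    ENNReal.ofReal_mul hpos.le]

lemma lintegral_rpow_mul_one_add_mul_rpow_neg {a h q : ℝ} (ha : 0 < a) (hah : a < h)
    (hq : 0 < q) :
    ∫⁻ r in Set.Ioi (0 : ℝ), ENNReal.ofReal (Gamma h * (r ^ (a - 1) * (1 + r * q) ^ (-h)))
      = ENNReal.ofReal (Gamma a * Gamma (h - a) * q ^ (-a)) := by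
  have hh : 0 < h := ha.trans hah
  have hGa := Gamma_pos_of_pos ha
  calc
    _ = ∫⁻ r in Set.Ioi (0 : ℝ), ∫⁻ u in Set.Ioi (0 : ℝ),
          ENNReal.ofReal (r ^ (a - 1) * (u ^ (h - 1) * exp (-((1 + r * q) * u)))) := by
        refine setLIntegral_congr_fun measurableSet_Ioi fun r (hr : 0 < r) => ?_
        have hra : 0 ≤ r ^ (a - 1) := by positivity
        simp_rw [ENNReal.ofReal_mul hra]
        rw [lintegral_const_mul' _ _ ENNReal.ofReal_ne_top,
          lintegral_rpow_mul_exp_neg_mul_Ioi hh (by positivity), ← ENNReal.ofReal_mul hra]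
        congr 1
        ring
    _ = ∫⁻ u in Set.Ioi (0 : ℝ), ∫⁻ r in Set.Ioi (0 : ℝ),
          ENNReal.ofReal (r ^ (a - 1) * (u ^ (h - 1) * exp (-((1 + r * q) * u)))) :=
        lintegral_lintegral_swap (by fun_prop)
    _ = ∫⁻ u in Set.Ioi (0 : ℝ), ENNReal.ofReal (Gamma a * q ^ (-a))
          * ENNReal.ofReal (u ^ (h - a - 1) * exp (-(1 * u))) := by
        refine setLIntegral_congr_fun measurableSet_Ioi fun u (hu : 0 < u) => ?_
        have hc : 0 ≤ u ^ (h - 1) * exp (-u) := by positivity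
        have key : ∀ r : ℝ, r ^ (a - 1) * (u ^ (h - 1) * exp (-((1 + r * q) * u)))
            = u ^ (h - 1) * exp (-u) * (r ^ (a - 1) * exp (-(u * q * r))) := by
          intro r
          have : exp (-((1 + r * q) * u)) = exp (-u) * exp (-(u * q * r)) := by
            rw [← exp_add]
            congr 1
            ring
          rw [this]
          ring
        simp_rw [key, ENNReal.ofReal_mul hc]
        rw [lintegral_const_mul' _ _ ENNReal.ofReal_ne_top,
          lintegral_rpow_mul_exp_neg_mul_Ioi ha (by positivity), ← ENNReal.ofReal_mul hc,
          ← ENNReal.ofReal_mul (by positivity), mul_rpow hu.le hq.le, one_mul,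
          show h - a - 1 = (h - 1) + (-a) by ring, rpow_add hu]
        congr 1
        ring
    _ = _ := by
        rw [lintegral_const_mul' _ _ ENNReal.ofReal_ne_top,
          lintegral_rpow_mul_exp_neg_mul_Ioi (sub_pos.2 hah) one_pos,
          ← ENNReal.ofReal_mul (by positivity), one_rpow]
        congr 1
        ring

lemma lintegral_one_add_norm_sq_rpow_mul_norm_sub_rpow {E : Type*} [NormedAddCommGroup E]
    [InnerProductSpace ℝ E] [FiniteDimensional ℝ E] [MeasurableSpace E] [BorelSpace E]
    [Nontrivial E] (x : E) {a s : ℝ} (ha : 0 < a) (has : a + s = Module.finrank ℝ E)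
    (had : a < (Module.finrank ℝ E : ℝ) / 2) :
    ENNReal.ofReal (Gamma a * Gamma s)
        * ∫⁻ y : E, ENNReal.ofReal ((1 + ‖y‖ ^ 2) ^ (-s) * ‖x - y‖ ^ (-(2 * a)))
      = ENNReal.ofReal (π ^ ((Module.finrank ℝ E : ℝ) / 2)
          * (Gamma a * Gamma ((Module.finrank ℝ E : ℝ) / 2 - a) * (1 + ‖x‖ ^ 2) ^ (-a))) := by
  set h : ℝ := (Module.finrank ℝ E : ℝ) / 2 with hh
  have hs : 0 < s := by linarith
  have hhpos : 0 < h := ha.trans had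
  have hGa := Gamma_pos_of_pos ha
  have hGs := Gamma_pos_of_pos hs
  have hGh := Gamma_pos_of_pos hhpos
  have hexp : s + a - 1 = (h - 1) + h := by linarith
  let F : E → ℝ → ℝ → ENNReal := fun y u r => ENNReal.ofReal
    (u ^ (s + a - 1) * r ^ (a - 1) * exp (-(u * (1 + (‖y‖ ^ 2 + r * ‖x - y‖ ^ 2)))))
  have hF : Measurable fun p : (E × ℝ) × ℝ => F p.1.1 p.1.2 p.2 := by
    fun_prop
  calc
    _ = ∫⁻ y : E, ∫⁻ u in Set.Ioi (0 : ℝ), ∫⁻ r in Set.Ioi (0 : ℝ), F y u r := by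
        rw [← lintegral_const_mul' _ _ ENNReal.ofReal_ne_top]
        refine lintegral_congr_ae ?_
        filter_upwards [(measure_eq_zero_iff_ae_notMem).1 (measure_singleton (μ := volume) x)]
          with y hy
        have hz : 0 < ‖x - y‖ := norm_pos_iff.2 (sub_ne_zero.2 fun e => hy e.symm)
        have hz' : (‖x - y‖ ^ 2) ^ (-a) = ‖x - y‖ ^ (-(2 * a)) := by
          rw [← rpow_natCast, ← rpow_mul hz.le]
          congr 1
          push_cast
          ring
        have inner : ∀ u ∈ Set.Ioi (0 : ℝ), ∫⁻ r in Set.Ioi (0 : ℝ), F y u r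
            = ENNReal.ofReal (Gamma a * ‖x - y‖ ^ (-(2 * a)))
              * ENNReal.ofReal (u ^ (s - 1) * exp (-((1 + ‖y‖ ^ 2) * u))) := by
          intro u (hu : 0 < u)
          have hc : 0 ≤ u ^ (s + a - 1) * exp (-((1 + ‖y‖ ^ 2) * u)) := by positivity
          have key : ∀ r : ℝ, F y u r
              = ENNReal.ofReal (u ^ (s + a - 1) * exp (-((1 + ‖y‖ ^ 2) * u)))
                * ENNReal.ofReal (r ^ (a - 1) * exp (-(u * ‖x - y‖ ^ 2 * r))) := by
            intro r
            have : exp (-(u * (1 + (‖y‖ ^ 2 + r * ‖x - y‖ ^ 2))))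
                = exp (-((1 + ‖y‖ ^ 2) * u)) * exp (-(u * ‖x - y‖ ^ 2 * r)) := by
              rw [← exp_add]
              congr 1
              ring
            simp only [F]
            rw [← ENNReal.ofReal_mul hc, this]
            congr 1
            ring
          simp_rw [key]
          rw [lintegral_const_mul' _ _ ENNReal.ofReal_ne_top,
            lintegral_rpow_mul_exp_neg_mul_Ioi ha (by positivity), ← ENNReal.ofReal_mul hc,
            ← ENNReal.ofReal_mul (by positivity), mul_rpow hu.le (by positivity), hz',
            show s - 1 = (s + a - 1) + (-a) by ring, rpow_add hu (s + a - 1) (-a)]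
          congr 1
          ring
        rw [setLIntegral_congr_fun measurableSet_Ioi inner,
          lintegral_const_mul' _ _ ENNReal.ofReal_ne_top,
          lintegral_rpow_mul_exp_neg_mul_Ioi hs (by positivity),
          ← ENNReal.ofReal_mul (by positivity), ← ENNReal.ofReal_mul (by positivity)]
        congr 1
        ring
    _ = ∫⁻ u in Set.Ioi (0 : ℝ), ∫⁻ y : E, ∫⁻ r in Set.Ioi (0 : ℝ), F y u r :=
        lintegral_lintegral_swap hF.lintegral_prod_right'.aemeasurable
    _ = ∫⁻ u in Set.Ioi (0 : ℝ), ∫⁻ r in Set.Ioi (0 : ℝ), ∫⁻ y : E, F y u r :=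
        lintegral_congr fun u => lintegral_lintegral_swap (by fun_prop)
    _ = ∫⁻ u in Set.Ioi (0 : ℝ), ∫⁻ r in Set.Ioi (0 : ℝ), ENNReal.ofReal
          (π ^ h * (r ^ (a - 1) * (1 + r) ^ (-h)) *
            (u ^ (h - 1) * exp (-((1 + r / (1 + r) * ‖x‖ ^ 2) * u)))) := by
        refine setLIntegral_congr_fun measurableSet_Ioi fun u (hu : 0 < u) => ?_
        refine setLIntegral_congr_fun measurableSet_Ioi fun r (hr : 0 < r) => ?_
        have hc : 0 ≤ u ^ (s + a - 1) * r ^ (a - 1) * exp (-u) := by positivity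
        have key : ∀ y : E, F y u r = ENNReal.ofReal (u ^ (s + a - 1) * r ^ (a - 1) * exp (-u))
            * ENNReal.ofReal (exp (-(u * (‖y‖ ^ 2 + r * ‖x - y‖ ^ 2)))) := by
          intro y
          simp only [F]
          rw [← ENNReal.ofReal_mul hc, mul_assoc _ (exp (-u)), ← exp_add]
          congr 3
          ring
        simp_rw [key]
        rw [lintegral_const_mul' _ _ ENNReal.ofReal_ne_top,
          lintegral_exp_neg_mul_norm_sq_add x hu hr, ← ENNReal.ofReal_mul hc, ← hh,
          div_rpow pi_pos.le (by positivity), mul_rpow hu.le (by positivity), hexp,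
          rpow_add hu, rpow_neg (by positivity)]
        have : exp (-((1 + r / (1 + r) * ‖x‖ ^ 2) * u))
            = exp (-u) * exp (-(u * (r / (1 + r) * ‖x‖ ^ 2))) := by
          rw [← exp_add]
          congr 1
          ring
        rw [this]
        congr 1
        have : 0 < u ^ h := by positivity
        have : 0 < (1 + r) ^ h := by positivity
        field_simp
    _ = ∫⁻ r in Set.Ioi (0 : ℝ), ∫⁻ u in Set.Ioi (0 : ℝ), ENNReal.ofReal
          (π ^ h * (r ^ (a - 1) * (1 + r) ^ (-h)) *
            (u ^ (h - 1) * exp (-((1 + r / (1 + r) * ‖x‖ ^ 2) * u)))) :=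
        lintegral_lintegral_swap (by fun_prop)
    _ = ∫⁻ r in Set.Ioi (0 : ℝ), ENNReal.ofReal (π ^ h)
          * ENNReal.ofReal (Gamma h * (r ^ (a - 1) * (1 + r * (1 + ‖x‖ ^ 2)) ^ (-h))) := by
        refine setLIntegral_congr_fun measurableSet_Ioi fun r (hr : 0 < r) => ?_
        have hc : 0 ≤ π ^ h * (r ^ (a - 1) * (1 + r) ^ (-h)) := by positivity
        simp_rw [ENNReal.ofReal_mul hc]
        rw [lintegral_const_mul' _ _ ENNReal.ofReal_ne_top,
          lintegral_rpow_mul_exp_neg_mul_Ioi hhpos (by positivity), ← ENNReal.ofReal_mul hc,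
          ← ENNReal.ofReal_mul (by positivity)]
        have : 1 + r * (1 + ‖x‖ ^ 2) = (1 + r) * (1 + r / (1 + r) * ‖x‖ ^ 2) := by
          field_simp
          ring
        rw [this, mul_rpow (by positivity) (by positivity)]
        congr 1
        ring
    _ = _ := by
        rw [lintegral_const_mul' _ _ ENNReal.ofReal_ne_top,
          lintegral_rpow_mul_one_add_mul_rpow_neg ha had (by positivity),
          ← ENNReal.ofReal_mul (by positivity)]

lemma integral_one_add_norm_sq_rpow_mul_norm_sub_rpow {E : Type*} [NormedAddCommGroup E]
    [InnerProductSpace ℝ E] [FiniteDimensional ℝ E] [MeasurableSpace E] [BorelSpace E]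
    [Nontrivial E] (x : E) {a s : ℝ} (ha : 0 < a) (has : a + s = Module.finrank ℝ E)
    (had : a < (Module.finrank ℝ E : ℝ) / 2) :
    ∫ y : E, (1 + ‖y‖ ^ 2) ^ (-s) * ‖x - y‖ ^ (-(2 * a))
      = π ^ ((Module.finrank ℝ E : ℝ) / 2) * Gamma ((Module.finrank ℝ E : ℝ) / 2 - a)
          / Gamma s * (1 + ‖x‖ ^ 2) ^ (-a) := by
  have hGa := Gamma_pos_of_pos ha
  have hGs : 0 < Gamma s := Gamma_pos_of_pos (by linarith)
  have hGd := Gamma_pos_of_pos (sub_pos.2 had)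
  have key := congrArg ENNReal.toReal
    (lintegral_one_add_norm_sq_rpow_mul_norm_sub_rpow x ha has had)
  rw [ENNReal.toReal_mul, ENNReal.toReal_ofReal (by positivity),
    ENNReal.toReal_ofReal (by positivity)] at key
  have hm : Measurable fun y : E => (1 + ‖y‖ ^ 2) ^ (-s) * ‖x - y‖ ^ (-(2 * a)) := by fun_prop
  rw [integral_eq_lintegral_of_nonneg_ae (ae_of_all _ fun y => by positivity)
    hm.aestronglyMeasurable]
  rw [div_mul_eq_mul_div, eq_div_iff hGs.ne']
  apply mul_left_cancel₀ hGa.ne'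
  linarith

theorem stmt12 (N : ℕ) (hN : 3 ≤ N) (lam : ℝ) (h0 : 0 < lam) (hlt : lam < N)
    (h4 : lam ≤ 4) :
    ∀ x : EuclideanSpace ℝ (Fin N),
      -laplacian (fun y => (1 + ‖y‖ ^ 2) ^ (-(((N : ℝ) - 2) / 2))) x
        = (N : ℝ) * ((N : ℝ) - 2) * Gamma ((N : ℝ) - lam / 2) /
            (π ^ ((N : ℝ) / 2) * Gamma (((N : ℝ) - lam) / 2)) *
          (∫ y : EuclideanSpace ℝ (Fin N),
              ((1 + ‖y‖ ^ 2) ^ (-(((N : ℝ) - 2) / 2)))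
                  ^ ((2 * (N : ℝ) - lam) / ((N : ℝ) - 2)) * ‖x - y‖ ^ (-lam)) *
          ((1 + ‖x‖ ^ 2) ^ (-(((N : ℝ) - 2) / 2)))
              ^ ((2 * (N : ℝ) - lam) / ((N : ℝ) - 2) - 1) := by
  intro x
  have hN' : (3 : ℝ) ≤ N := by exact_mod_cast hN
  have hN2 : (N : ℝ) - 2 ≠ 0 := by linarith
  have : Nonempty (Fin N) := ⟨⟨0, by lia⟩⟩
  have hq : ∀ y : EuclideanSpace ℝ (Fin N), 0 < 1 + ‖y‖ ^ 2 := fun y => by positivity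
  have e1 : -(((N : ℝ) - 2) / 2) * ((2 * (N : ℝ) - lam) / ((N : ℝ) - 2))
      = -((N : ℝ) - lam / 2) := by
    field_simp
  have e2 : -(((N : ℝ) - 2) / 2) * ((2 * (N : ℝ) - lam) / ((N : ℝ) - 2) - 1)
      = -(((N : ℝ) + 2) / 2) + lam / 2 := by
    field_simp
    ring
  have hI := integral_one_add_norm_sq_rpow_mul_norm_sub_rpow x (a := lam / 2)
    (s := (N : ℝ) - lam / 2) (by linarith) (by simp) (by simp; linarith)
  rw [finrank_euclideanSpace_fin, mul_div_cancel₀ lam two_ne_zero, ← sub_div] at hI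
  have hG1 := Gamma_pos_of_pos (show 0 < (N : ℝ) - lam / 2 by linarith)
  have hG2 := Gamma_pos_of_pos (show 0 < ((N : ℝ) - lam) / 2 by linarith)
  have hpi : 0 < π ^ ((N : ℝ) / 2) := by positivity
  have hqa : 0 < (1 + ‖x‖ ^ 2) ^ (lam / 2) := rpow_pos_of_pos (hq x) _
  simp_rw [← rpow_mul (hq _).le, e1, e2]
  rw [neg_laplacian_one_add_norm_sq_rpow, hI, rpow_add (hq x), rpow_neg (hq x).le (lam / 2)]
  generalize Gamma ((N : ℝ) - lam / 2) = G at *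
  field_simp
end

section
/- Let N ≥ 3 and U(x) = (1+|x|²)^{−(N−2)/2}, Z_j as in context, H_j = U^{4/(N−2)} Z_j. Then for each j ∈ {0,1,…,N} and all x ∈ ℝ^N, Z_j(x) = ((N+2)/((N−2)ω_N)) ∫_{ℝ^N} H_j(y)|x−y|^{−(N−2)} dy, where ω_N = 2π^{N/2}/(N Γ(N/2)). -/
open MeasureTheory Real
open Set Filter Topology Module

/-- Fubini's theorem for the superposition `K a = ∫ b, k a b` of a nonnegative kernel. -/
theorem integral_mul_eq_integral_integral_mul {α β : Type*} [MeasurableSpace α]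
    [MeasurableSpace β] {μ : Measure α} {ν : Measure β} [SFinite μ] [SFinite ν]
    {g K : α → ℝ} {k : α → β → ℝ} (hg : Measurable g) (hk : Measurable (Function.uncurry k))
    (hk0 : ∀ᵐ a ∂μ, ∀ᵐ b ∂ν, 0 ≤ k a b) (hki : ∀ᵐ a ∂μ, Integrable (k a) ν)
    (hK : ∀ᵐ a ∂μ, ∫ b, k a b ∂ν = K a) (hint : Integrable (fun a ↦ g a * K a) μ) :
    ∫ a, g a * K a ∂μ = ∫ b, ∫ a, g a * k a b ∂μ ∂ν := by
  have hI : Integrable (Function.uncurry fun a b ↦ g a * k a b) (μ.prod ν) := by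
    have hm : Measurable (Function.uncurry fun a b ↦ g a * k a b) :=
      (hg.comp measurable_fst).mul hk
    rw [integrable_prod_iff hm.aestronglyMeasurable]
    refine ⟨hki.mono fun a ha ↦ ha.const_mul (g a), hint.norm.congr ?_⟩
    filter_upwards [hk0, hK] with a h0 hKa
    simp only [Function.uncurry_apply_pair, norm_mul]
    rw [integral_const_mul, ← hKa, norm_of_nonneg (integral_nonneg_of_ae h0)]
    congr 1
    exact integral_congr_ae (h0.mono fun b hb ↦ (norm_of_nonneg hb).symm)
  rw [← integral_integral_swap hI]
  exact integral_congr_ae (hK.mono fun a ha ↦ by simp only [integral_const_mul, ha])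

theorem integrableOn_rpow_mul_exp_neg_mul {a r : ℝ} (ha : 0 < a) (hr : 0 < r) :
    IntegrableOn (fun t : ℝ ↦ t ^ (a - 1) * exp (-(r * t))) (Ioi 0) := by
  simpa using integrableOn_rpow_mul_exp_neg_mul_rpow (by linarith : -1 < a - 1) one_pos hr

theorem Gamma_mul_integral_mul_rpow_neg {α : Type*} [MeasurableSpace α] {μ : Measure α}
    [SFinite μ] {g q : α → ℝ} {a : ℝ} (ha : 0 < a) (hg : Measurable g) (hq : Measurable q)
    (hq0 : ∀ᵐ x ∂μ, 0 < q x) (hint : Integrable (fun x ↦ g x * q x ^ (-a)) μ) :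
    Gamma a * ∫ x, g x * q x ^ (-a) ∂μ =
      ∫ t in Ioi 0, t ^ (a - 1) * ∫ x, g x * exp (-(q x * t)) ∂μ := by
  rw [← integral_const_mul]
  have h := integral_mul_eq_integral_integral_mul (μ := μ) (ν := volume.restrict (Ioi 0))
    (g := g) (K := fun x ↦ Gamma a * q x ^ (-a))
    (k := fun x t ↦ t ^ (a - 1) * exp (-(q x * t))) hg ?_ ?_ ?_ ?_ ?_
  · rw [show (fun x ↦ Gamma a * (g x * q x ^ (-a))) = fun x ↦ g x * (Gamma a * q x ^ (-a)) by
      ext; ring, h]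
    refine integral_congr_ae (ae_of_all _ fun t ↦ ?_)
    simp only [← integral_const_mul]
    congr 1; ext x; ring
  · exact (measurable_snd.pow_const _).mul (((hq.comp measurable_fst).mul measurable_snd).neg.exp)
  · refine ae_of_all _ fun x ↦ (ae_restrict_mem measurableSet_Ioi).mono fun t ht ↦ ?_
    have : (0 : ℝ) < t := ht
    positivity
  · exact hq0.mono fun x hx ↦ integrableOn_rpow_mul_exp_neg_mul ha hx
  · refine hq0.mono fun x hx ↦ ?_
    rw [integral_rpow_mul_exp_neg_mul_Ioi ha hx, one_div, inv_rpow hx.le, rpow_neg hx.le, mul_comm]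
  · exact (hint.const_mul (Gamma a)).congr (ae_of_all _ fun x ↦ by ring)

section HalfLine

variable {a b s ρ A B : ℝ}

theorem tendsto_div_one_add_mul_atTop (hρ : 0 < ρ) :
    Tendsto (fun σ : ℝ ↦ σ / (1 + ρ * σ)) atTop (𝓝 ρ⁻¹) := by
  have h : Tendsto (fun σ : ℝ ↦ (σ⁻¹ + ρ)⁻¹) atTop (𝓝 (0 + ρ)⁻¹) :=
    (tendsto_inv_atTop_zero.add_const ρ).inv₀ (by simpa using hρ.ne')
  rw [zero_add] at h
  refine h.congr' ((eventually_gt_atTop 0).mono fun σ hσ ↦ ?_)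
  have : 0 < 1 + ρ * σ := by positivity
  field_simp

theorem hasDerivAt_div_one_add_mul_rpow (hb : 0 < b) (hρ : 0 < ρ) {σ : ℝ} (hσ : 0 < σ) :
    HasDerivAt (fun σ : ℝ ↦ (σ / (1 + ρ * σ)) ^ b / b)
      (σ ^ (b - 1) * (1 + ρ * σ) ^ (-(b + 1))) σ := by
  have h1 : 0 < 1 + ρ * σ := by positivity
  have h2 : HasDerivAt (fun σ : ℝ ↦ σ / (1 + ρ * σ)) ((1 + ρ * σ) ^ (-2 : ℝ)) σ := by
    refine ((hasDerivAt_id σ).div (((hasDerivAt_id σ).const_mul ρ).const_add 1)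
      h1.ne').congr_deriv ?_
    rw [rpow_neg h1.le, rpow_two]
    simp only [id]
    field_simp
    ring
  refine ((h2.rpow_const (p := b) (Or.inl (by positivity))).div_const b).congr_deriv ?_
  rw [div_rpow hσ.le h1.le, show -(b + 1) = -2 + -(b - 1) by ring, rpow_add h1,
    rpow_neg h1.le (b - 1)]
  field_simp

theorem continuousWithinAt_div_one_add_mul_rpow (hb : 0 < b) :
    ContinuousWithinAt (fun σ : ℝ ↦ (σ / (1 + ρ * σ)) ^ b / b) (Ici 0) 0 := by
  refine ContinuousAt.continuousWithinAt (ContinuousAt.div_const (ContinuousAt.rpow_const ?_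
    (Or.inr hb.le)) b)
  exact continuousAt_id.div (by fun_prop) (by simp)

theorem tendsto_div_one_add_mul_rpow (hb : 0 < b) (hρ : 0 < ρ) :
    Tendsto (fun σ : ℝ ↦ (σ / (1 + ρ * σ)) ^ b / b) atTop (𝓝 (ρ ^ (-b) / b)) := by
  rw [rpow_neg hρ.le, ← inv_rpow hρ.le]
  exact ((tendsto_div_one_add_mul_atTop hρ).rpow_const (Or.inr hb.le)).div_const b

theorem integrableOn_rpow_mul_one_add_mul_rpow (hb : 0 < b) (hρ : 0 < ρ) :
    IntegrableOn (fun σ : ℝ ↦ σ ^ (b - 1) * (1 + ρ * σ) ^ (-(b + 1))) (Ioi 0) := by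
  refine integrableOn_Ioi_deriv_of_nonneg (continuousWithinAt_div_one_add_mul_rpow hb)
    (fun σ hσ ↦ hasDerivAt_div_one_add_mul_rpow hb hρ hσ) (fun σ hσ ↦ ?_)
    (tendsto_div_one_add_mul_rpow hb hρ)
  have : (0 : ℝ) < σ := hσ
  positivity

theorem integral_rpow_mul_one_add_mul_rpow (hb : 0 < b) (hρ : 0 < ρ) :
    ∫ σ in Ioi (0 : ℝ), σ ^ (b - 1) * (1 + ρ * σ) ^ (-(b + 1)) = ρ ^ (-b) / b := by
  rw [integral_Ioi_of_hasDerivAt_of_nonneg (continuousWithinAt_div_one_add_mul_rpow hb)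
    (fun σ hσ ↦ hasDerivAt_div_one_add_mul_rpow hb hρ hσ) (fun σ hσ ↦ ?_)
    (tendsto_div_one_add_mul_rpow hb hρ)]
  · simp [hb.ne']
  · have : (0 : ℝ) < σ := hσ
    positivity

theorem integrableOn_rpow_mul_one_add_rpow (ha : 0 < a) (hs : 1 ≤ s) :
    IntegrableOn (fun σ : ℝ ↦ σ ^ (a - 1) * (1 + σ) ^ (-(s + a))) (Ioi 0) := by
  refine (integrableOn_rpow_mul_one_add_mul_rpow ha one_pos).mono' (by fun_prop) ?_
  refine (ae_restrict_mem measurableSet_Ioi).mono fun σ hσ ↦ ?_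
  have h : (0 : ℝ) < σ := hσ
  rw [norm_of_nonneg (by positivity), one_mul]
  exact mul_le_mul_of_nonneg_left
    (rpow_le_rpow_of_exponent_le (by linarith) (by linarith)) (by positivity)

theorem integral_rpow_mul_one_add_rpow (ha : 0 < a) (hs : 1 ≤ s) :
    ∫ σ in Ioi (0 : ℝ), σ ^ (a - 1) * (1 + σ) ^ (-(s + a)) =
      Gamma s * Gamma a / Gamma (s + a) := by
  have hs0 : 0 < s := by linarith
  rw [eq_div_iff (Gamma_pos_of_pos (by positivity)).ne', mul_comm,
    Gamma_mul_integral_mul_rpow_neg (by positivity) (by fun_prop) (by fun_prop)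
      ((ae_restrict_mem measurableSet_Ioi).mono fun σ (hσ : 0 < σ) ↦ by positivity)
      (integrableOn_rpow_mul_one_add_rpow ha hs), Gamma_eq_integral hs0, ← integral_mul_const]
  refine setIntegral_congr_fun measurableSet_Ioi fun t ht ↦ ?_
  have h : (0 : ℝ) < t := ht
  have : ∀ σ : ℝ, σ ^ (a - 1) * exp (-((1 + σ) * t)) =
      exp (-t) * (σ ^ (a - 1) * exp (-(t * σ))) := fun σ ↦ by
    rw [mul_left_comm, ← exp_add]; ring_nf
  simp only [this]
  rw [integral_const_mul, integral_rpow_mul_exp_neg_mul_Ioi ha h, one_div, inv_rpow h.le,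
    show s + a - 1 = (s - 1) + a by ring, rpow_add h]
  have := (rpow_pos_of_pos h a).ne'
  field_simp

theorem rpow_mul_add_mul_rpow_eq (hA : 0 < A) (hB : 0 < B) {σ : ℝ} (hσ : 0 < σ) :
    σ ^ (a - 1) * (A + σ * B) ^ (-(s + a)) =
      A ^ (-s) * B ^ (-a) * (B / A) *
        ((B / A * σ) ^ (a - 1) * (1 + B / A * σ) ^ (-(s + a))) := by
  have h : A + σ * B = A * (1 + B / A * σ) := by field_simp
  rw [h, mul_rpow hA.le (by positivity), mul_rpow (by positivity) hσ.le, div_rpow hB.le hA.le,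
    show -(s + a) = -s + -(a - 1) - 1 by ring, rpow_sub_one hA.ne', rpow_add hA, 
    rpow_neg hA.le (a - 1),
    show -a = -(a - 1) - 1 by ring, rpow_sub_one hB.ne', rpow_neg hB.le (a - 1)]
  have := (rpow_pos_of_pos hA (a - 1)).ne'
  have := (rpow_pos_of_pos hB (a - 1)).ne'
  field_simp

theorem integrableOn_rpow_mul_add_mul_rpow (ha : 0 < a) (hs : 1 ≤ s) (hA : 0 < A) (hB : 0 < B) :
    IntegrableOn (fun σ : ℝ ↦ σ ^ (a - 1) * (A + σ * B) ^ (-(s + a))) (Ioi 0) := by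
  have h := (integrableOn_Ioi_comp_mul_left_iff
    (fun σ : ℝ ↦ σ ^ (a - 1) * (1 + σ) ^ (-(s + a))) 0 (div_pos hB hA)).2
      (by simpa using integrableOn_rpow_mul_one_add_rpow ha hs)
  exact IntegrableOn.congr_fun (h.const_mul (A ^ (-s) * B ^ (-a) * (B / A)))
    (fun σ hσ ↦ (rpow_mul_add_mul_rpow_eq hA hB hσ).symm) measurableSet_Ioi

/-- Feynman's parametrization of a product of powers. -/
theorem integral_rpow_mul_add_mul_rpow (ha : 0 < a) (hs : 1 ≤ s) (hA : 0 < A) (hB : 0 < B) :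
    ∫ σ in Ioi (0 : ℝ), σ ^ (a - 1) * (A + σ * B) ^ (-(s + a)) =
      Gamma s * Gamma a / Gamma (s + a) * (A ^ (-s) * B ^ (-a)) := by
  rw [setIntegral_congr_fun measurableSet_Ioi fun σ hσ ↦ rpow_mul_add_mul_rpow_eq hA hB hσ,
    integral_const_mul, integral_comp_mul_left_Ioi
      (fun σ : ℝ ↦ σ ^ (a - 1) * (1 + σ) ^ (-(s + a))) 0 (div_pos hB hA), mul_zero,
    integral_rpow_mul_one_add_rpow ha hs, smul_eq_mul]
  field_simp

end HalfLine

section EuclideanIntegrals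

variable {E : Type*} [NormedAddCommGroup E] [InnerProductSpace ℝ E]

theorem abs_add_continuousLinearMap_le (α : ℝ) (ℓ : E →L[ℝ] ℝ) (y : E) :
    |α + ℓ y| ≤ (|α| + ‖ℓ‖) * (1 + ‖y‖ ^ 2) ^ (1 / 2 : ℝ) := by
  rw [← sqrt_eq_rpow]
  have h1 : 1 ≤ √(1 + ‖y‖ ^ 2) := one_le_sqrt.2 (by nlinarith [sq_nonneg ‖y‖])
  have h2 : ‖y‖ ≤ √(1 + ‖y‖ ^ 2) := le_sqrt_of_sq_le (by linarith)
  have h3 : |ℓ y| ≤ ‖ℓ‖ * ‖y‖ := ℓ.le_opNorm y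
  calc |α + ℓ y| ≤ |α| + ‖ℓ‖ * ‖y‖ := (abs_add_le _ _).trans (by linarith)
    _ ≤ |α| * √(1 + ‖y‖ ^ 2) + ‖ℓ‖ * √(1 + ‖y‖ ^ 2) := by
      gcongr
      exact le_mul_of_one_le_right (abs_nonneg _) h1
    _ = _ := by ring

theorem abs_add_mul_rpow_le (α : ℝ) (ℓ : E →L[ℝ] ℝ) (k : ℝ) (y : E) :
    |(α + ℓ y) * (1 + ‖y‖ ^ 2) ^ (-k)| ≤
      (|α| + ‖ℓ‖) * (1 + ‖y‖ ^ 2) ^ (-(2 * k - 1) / 2) := by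
  have h : (0 : ℝ) < 1 + ‖y‖ ^ 2 := by positivity
  rw [abs_mul, abs_of_pos (rpow_pos_of_pos h _), show -(2 * k - 1) / 2 = 1 / 2 + -k by ring,
    rpow_add h, ← mul_assoc]
  gcongr
  exact abs_add_continuousLinearMap_le α ℓ y

theorem one_add_norm_sq_add_mul_norm_sub_sq (x w : E) {σ R : ℝ} (hσ : 0 < σ)
    (hR : R ^ 2 = (1 + (1 + ‖x‖ ^ 2) * σ) / (1 + σ) ^ 2) :
    1 + ‖R • w + (σ / (1 + σ)) • x‖ ^ 2 + σ * ‖x - (R • w + (σ / (1 + σ)) • x)‖ ^ 2 =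
      (1 + (1 + ‖x‖ ^ 2) * σ) / (1 + σ) * (1 + ‖w‖ ^ 2) := by
  have h : x - (R • w + (σ / (1 + σ)) • x) = (1 / (1 + σ)) • x - R • w := by
    have : (1 / (1 + σ)) = 1 - σ / (1 + σ) := by field_simp; ring
    rw [this]; module
  have h' : (1 + (1 + ‖x‖ ^ 2) * σ) = R ^ 2 * (1 + σ) ^ 2 := by rw [hR]; field_simp
  rw [h, norm_add_sq_real, norm_sub_sq_real]
  simp only [norm_smul, inner_smul_left, inner_smul_right, mul_pow, Real.norm_eq_abs, sq_abs,
    real_inner_comm x w, RCLike.conj_to_real]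
  have hx : ‖x‖ ^ 2 = (R ^ 2 * (1 + σ) ^ 2 - 1) / σ - 1 := by
    rw [← h']; field_simp; ring
  rw [hx]
  field_simp
  ring

variable [FiniteDimensional ℝ E] [MeasurableSpace E] [BorelSpace E]

theorem integrable_add_mul_rpow_one_add_norm_sq (α : ℝ) (ℓ : E →L[ℝ] ℝ) {k : ℝ}
    (hk : (finrank ℝ E : ℝ) + 1 < 2 * k) :
    Integrable fun y : E ↦ (α + ℓ y) * (1 + ‖y‖ ^ 2) ^ (-k) :=
  ((integrable_rpow_neg_one_add_norm_sq (r := 2 * k - 1) (by linarith)).const_mul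
    (|α| + ‖ℓ‖)).mono' (Measurable.aestronglyMeasurable (by fun_prop))
    (ae_of_all _ (abs_add_mul_rpow_le α ℓ k))

theorem integral_rpow_neg_one_add_norm_sq {k : ℝ} (hk : (finrank ℝ E : ℝ) < 2 * k) :
    ∫ y : E, (1 + ‖y‖ ^ 2) ^ (-k) =
      π ^ (finrank ℝ E / 2 : ℝ) * Gamma (k - finrank ℝ E / 2) / Gamma k := by
  have hn : (0 : ℝ) ≤ finrank ℝ E := Nat.cast_nonneg _
  have hk0 : 0 < k := by linarith
  have hint : Integrable fun y : E ↦ (1 : ℝ) * (1 + ‖y‖ ^ 2) ^ (-k) := by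
    convert integrable_rpow_neg_one_add_norm_sq (E := E) (μ := volume) (r := 2 * k) hk using 2
    rw [one_mul]; congr 1; ring
  have h := Gamma_mul_integral_mul_rpow_neg hk0 (measurable_const (a := (1 : ℝ)))
    (by fun_prop) (ae_of_all _ fun y ↦ by positivity) hint
  simp only [one_mul] at h
  rw [eq_div_iff (Gamma_pos_of_pos hk0).ne', mul_comm, h,
    Gamma_eq_integral (by linarith : 0 < k - finrank ℝ E / 2), ← integral_const_mul]
  refine setIntegral_congr_fun measurableSet_Ioi fun t ht ↦ ?_
  have ht0 : (0 : ℝ) < t := ht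
  have : ∀ y : E, exp (-((1 + ‖y‖ ^ 2) * t)) = exp (-t) * exp (-t * ‖y‖ ^ 2) := fun y ↦ by
    rw [← exp_add]; ring_nf
  simp only [this]
  rw [integral_const_mul, GaussianFourier.integral_rexp_neg_mul_sq_norm ht0,
    div_rpow pi_pos.le ht0.le, show k - (finrank ℝ E : ℝ) / 2 - 1 = k - 1 - finrank ℝ E / 2 by ring,
    rpow_sub ht0 (k - 1)]
  ring

theorem integral_add_mul_rpow_one_add_norm_sq_add (α : ℝ) (ℓ : E →L[ℝ] ℝ) {k : ℝ}
    (hk : (finrank ℝ E : ℝ) + 1 < 2 * k) (x : E) {σ : ℝ} (hσ : 0 < σ) :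
    ∫ y : E, (α + ℓ y) * (1 + ‖y‖ ^ 2 + σ * ‖x - y‖ ^ 2) ^ (-k) =
      π ^ (finrank ℝ E / 2 : ℝ) * Gamma (k - finrank ℝ E / 2) / Gamma k *
        ((α + σ / (1 + σ) * ℓ x) * (1 + σ) ^ (k - finrank ℝ E) *
          (1 + (1 + ‖x‖ ^ 2) * σ) ^ (-(k - finrank ℝ E / 2))) := by
  set q := 1 + (1 + ‖x‖ ^ 2) * σ with hq
  have hq0 : 0 < q := by positivity
  have hm : 0 < 1 + σ := by positivity
  set R := √(q / (1 + σ) ^ 2) with hR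
  have hR0 : 0 < R := sqrt_pos.2 (by positivity)
  have hR2 : R ^ 2 = q / (1 + σ) ^ 2 := sq_sqrt (by positivity)
  have hodd : ∫ w : E, ℓ w * (1 + ‖w‖ ^ 2) ^ (-k) = 0 := by
    have := integral_neg_eq_self (fun w : E ↦ ℓ w * (1 + ‖w‖ ^ 2) ^ (-k)) volume
    simp only [map_neg, norm_neg, neg_mul, integral_neg] at this
    linarith
  have hpt : ∀ w : E, (α + ℓ (R • w + (σ / (1 + σ)) • x)) *
      (1 + ‖R • w + (σ / (1 + σ)) • x‖ ^ 2 +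
        σ * ‖x - (R • w + (σ / (1 + σ)) • x)‖ ^ 2) ^ (-k) =
      (q / (1 + σ)) ^ (-k) * ((α + σ / (1 + σ) * ℓ x) * (1 + ‖w‖ ^ 2) ^ (-k)
        + R * (ℓ w * (1 + ‖w‖ ^ 2) ^ (-k))) := fun w ↦ by
    rw [one_add_norm_sq_add_mul_norm_sub_sq x w hσ hR2, mul_rpow (by positivity) (by positivity)]
    simp only [map_add, map_smul, smul_eq_mul]
    ring
  have hscale := Measure.integral_comp_smul (volume : Measure E)
    (fun v ↦ (α + ℓ (v + (σ / (1 + σ)) • x)) *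
      (1 + ‖v + (σ / (1 + σ)) • x‖ ^ 2 + σ * ‖x - (v + (σ / (1 + σ)) • x)‖ ^ 2) ^ (-k)) R
  rw [integral_add_right_eq_self (fun y : E ↦ (α + ℓ y) *
    (1 + ‖y‖ ^ 2 + σ * ‖x - y‖ ^ 2) ^ (-k)), abs_of_pos (by positivity), smul_eq_mul,
    inv_mul_eq_div, eq_comm, div_eq_iff (by positivity)] at hscale
  have hi0 : Integrable fun w : E ↦ (1 + ‖w‖ ^ 2) ^ (-k) := by
    simpa using integrable_add_mul_rpow_one_add_norm_sq 1 (0 : E →L[ℝ] ℝ) hk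
  have hi1 : Integrable fun w : E ↦ ℓ w * (1 + ‖w‖ ^ 2) ^ (-k) := by
    simpa using integrable_add_mul_rpow_one_add_norm_sq 0 ℓ hk
  rw [hscale]
  simp only [hpt]
  rw [integral_const_mul, integral_add (hi0.const_mul _) (hi1.const_mul _), integral_const_mul,
    integral_const_mul, hodd, integral_rpow_neg_one_add_norm_sq (by linarith)]
  have hRn : R ^ finrank ℝ E = q ^ (finrank ℝ E / 2 : ℝ) * (1 + σ) ^ (-(finrank ℝ E : ℝ)) := by
    rw [hR, sqrt_eq_rpow, ← rpow_mul_natCast (by positivity), div_rpow hq0.le (by positivity),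
      ← rpow_natCast (1 + σ) 2, ← rpow_mul hm.le, rpow_neg hm.le, div_eq_mul_inv]
    push_cast
    ring_nf
  rw [hRn, div_rpow hq0.le hm.le, rpow_neg hm.le k, div_inv_eq_mul, sub_eq_add_neg k (finrank ℝ E : ℝ),
    rpow_add hm, show -(k - (finrank ℝ E : ℝ) / 2) = -k + finrank ℝ E / 2 by ring, rpow_add hq0]
  ring

theorem integrable_indicator_ball_rpow_neg {a : ℝ} (ha : 0 < a)
    (han : 2 * a < finrank ℝ E) :
    Integrable ((Metric.ball (0 : E) 1).indicator fun z ↦ (‖z‖ ^ 2) ^ (-a)) := by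
  have hn : 0 < finrank ℝ E := by
    have : (0 : ℝ) < finrank ℝ E := by linarith
    exact_mod_cast this
  have : Nontrivial E := finrank_pos_iff.1 hn
  rw [integrable_indicator_iff measurableSet_ball,
    integrableOn_fun_norm_addHaar volume (f := fun r ↦ (r ^ 2) ^ (-a))]
  refine ((intervalIntegral.integrableOn_Ioo_rpow_iff one_pos).2
    (by linarith : -1 < (finrank ℝ E : ℝ) - 1 - 2 * a)).congr_fun (fun r hr ↦ ?_) measurableSet_Ioo
  have hr0 : 0 < r := hr.1
  simp only [smul_eq_mul]
  rw [← rpow_natCast r 2, ← rpow_mul hr0.le, ← rpow_natCast r, ← rpow_add hr0,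
    Nat.cast_sub (by omega)]
  congr 1
  push_cast
  ring

theorem integrable_add_mul_rpow_mul_rpow_norm_sub (α : ℝ) (ℓ : E →L[ℝ] ℝ) {s a : ℝ} (ha : 0 < a)
    (han : 2 * a < finrank ℝ E) (hs : (finrank ℝ E : ℝ) + 1 < 2 * s) (x : E) :
    Integrable fun y : E ↦ (α + ℓ y) * ((1 + ‖y‖ ^ 2) ^ (-s) * (‖x - y‖ ^ 2) ^ (-a)) := by
  have h1 := (integrable_add_mul_rpow_one_add_norm_sq α ℓ hs).norm
  have h2 := ((integrable_indicator_ball_rpow_neg (E := E) ha han).comp_sub_left x).const_mul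
    (|α| + ‖ℓ‖)
  refine (h1.add h2).mono' (Measurable.aestronglyMeasurable (by fun_prop)) (ae_of_all _ fun y ↦ ?_)
  have h3 : |(α + ℓ y) * (1 + ‖y‖ ^ 2) ^ (-s)| ≤ |α| + ‖ℓ‖ := by
    refine (abs_add_mul_rpow_le α ℓ s y).trans (mul_le_of_le_one_right (by positivity) ?_)
    exact rpow_le_one_of_one_le_of_nonpos (by nlinarith [sq_nonneg ‖y‖])
      (by have := (Nat.cast_nonneg (finrank ℝ E) : (0 : ℝ) ≤ _); linarith)
  have h4 : 0 ≤ (‖x - y‖ ^ 2) ^ (-a) := by positivity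
  rw [← mul_assoc, norm_mul, norm_of_nonneg h4]
  simp only [Pi.add_apply, Real.norm_eq_abs]
  by_cases hy : x - y ∈ Metric.ball (0 : E) 1
  · rw [indicator_of_mem hy]
    nlinarith [abs_nonneg ((α + ℓ y) * (1 + ‖y‖ ^ 2) ^ (-s)), mul_le_mul_of_nonneg_right h3 h4]
  · rw [indicator_of_notMem hy, mul_zero, add_zero]
    refine mul_le_of_le_one_right (abs_nonneg _) (rpow_le_one_of_one_le_of_nonpos ?_ (by linarith))
    exact one_le_pow₀ (by simpa using hy)

/-- The Riesz potential of an affine function times a power of `1 + ‖y‖ ^ 2`, as an integral over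
the half-line. -/
theorem integral_add_mul_rpow_mul_rpow_norm_sub (α : ℝ) (ℓ : E →L[ℝ] ℝ) {s a : ℝ} (ha : 0 < a)
    (han : 2 * a < finrank ℝ E) (hs : (finrank ℝ E : ℝ) + 1 < 2 * s) (x : E) :
    ∫ y : E, (α + ℓ y) * ((1 + ‖y‖ ^ 2) ^ (-s) * (‖x - y‖ ^ 2) ^ (-a)) =
      π ^ (finrank ℝ E / 2 : ℝ) * Gamma (s + a - finrank ℝ E / 2) / (Gamma s * Gamma a) *
        ∫ σ in Ioi (0 : ℝ), σ ^ (a - 1) * ((α + σ / (1 + σ) * ℓ x) *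
          (1 + σ) ^ (s + a - finrank ℝ E) *
            (1 + (1 + ‖x‖ ^ 2) * σ) ^ (-(s + a - finrank ℝ E / 2))) := by
  have hn1 : 1 ≤ finrank ℝ E := by
    have : (0 : ℝ) < finrank ℝ E := by linarith
    exact_mod_cast this
  have hn1' : (1 : ℝ) ≤ finrank ℝ E := by exact_mod_cast hn1
  have : Nontrivial E := finrank_pos_iff.1 hn1
  have hs1 : 1 ≤ s := by linarith
  have hG1 := Gamma_pos_of_pos ha
  have hG2 := Gamma_pos_of_pos (by linarith : 0 < s)
  have hG3 := Gamma_pos_of_pos (by linarith : 0 < s + a)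
  have hpos : ∀ᵐ y : E, 0 < ‖x - y‖ ^ 2 := by
    filter_upwards [compl_mem_ae_iff.2 (measure_singleton x)] with y hy
    have : x - y ≠ 0 := sub_ne_zero.2 fun h ↦ hy h.symm
    positivity
  have h := integral_mul_eq_integral_integral_mul (μ := (volume : Measure E))
    (ν := volume.restrict (Ioi (0 : ℝ))) (g := fun y ↦ α + ℓ y)
    (K := fun y ↦ Gamma s * Gamma a / Gamma (s + a) *
      ((1 + ‖y‖ ^ 2) ^ (-s) * (‖x - y‖ ^ 2) ^ (-a)))
    (k := fun y σ ↦ σ ^ (a - 1) * (1 + ‖y‖ ^ 2 + σ * ‖x - y‖ ^ 2) ^ (-(s + a)))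
    (by fun_prop) (by fun_prop)
    (ae_of_all _ fun y ↦ (ae_restrict_mem measurableSet_Ioi).mono fun σ (hσ : 0 < σ) ↦ by
      positivity)
    (hpos.mono fun y hy ↦ integrableOn_rpow_mul_add_mul_rpow ha hs1 (by positivity) hy)
    (hpos.mono fun y hy ↦ integral_rpow_mul_add_mul_rpow ha hs1 (by positivity) hy)
    (((integrable_add_mul_rpow_mul_rpow_norm_sub α ℓ ha han hs x).const_mul
      (Gamma s * Gamma a / Gamma (s + a))).congr (ae_of_all _ fun y ↦ by ring))
  simp only [mul_left_comm _ (Gamma s * Gamma a / Gamma (s + a))] at h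
  rw [integral_const_mul, setIntegral_congr_fun (g := fun σ ↦
    π ^ (finrank ℝ E / 2 : ℝ) * Gamma (s + a - finrank ℝ E / 2) / Gamma (s + a) *
      (σ ^ (a - 1) * ((α + σ / (1 + σ) * ℓ x) * (1 + σ) ^ (s + a - finrank ℝ E) *
        (1 + (1 + ‖x‖ ^ 2) * σ) ^ (-(s + a - finrank ℝ E / 2))))) measurableSet_Ioi,
    integral_const_mul] at h
  · rw [div_mul_eq_mul_div, div_mul_eq_mul_div, div_left_inj' hG3.ne'] at h
    rw [div_mul_eq_mul_div, eq_div_iff (by positivity), mul_comm, h]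
  · intro σ hσ
    simp only [mul_left_comm _ (σ ^ (a - 1))]
    rw [integral_const_mul, integral_add_mul_rpow_one_add_norm_sq_add α ℓ (by linarith) x hσ]

end EuclideanIntegrals

section NewtonianPotential

variable {E : Type*} [NormedAddCommGroup E] [InnerProductSpace ℝ E] [FiniteDimensional ℝ E]
  [MeasurableSpace E] [BorelSpace E] {a : ℝ}

theorem integral_rpow_mul_rpow_norm_sub (ha : 0 < a) (hn : (finrank ℝ E : ℝ) = 2 * a + 2) (x : E) :
    ∫ y : E, (1 + ‖y‖ ^ 2) ^ (-(a + 2)) * (‖x - y‖ ^ 2) ^ (-a) =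
      π ^ (a + 1) / Gamma (a + 2) * (1 + ‖x‖ ^ 2) ^ (-a) := by
  have hρ : 0 < 1 + ‖x‖ ^ 2 := by positivity
  have hG := (Gamma_pos_of_pos ha).ne'
  have h := integral_add_mul_rpow_mul_rpow_norm_sub 1 (0 : E →L[ℝ] ℝ) (s := a + 2) ha
    (by linarith) (by linarith) x
  rw [hn, show a + 2 + a - (2 * a + 2) / 2 = a + 1 by ring,
    show a + 2 + a - (2 * a + 2) = 0 by ring, show (2 * a + 2) / 2 = a + 1 by ring] at h
  simp only [_root_.zero_apply, add_zero, mul_zero, one_mul, rpow_zero] at h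
  rw [h, integral_rpow_mul_one_add_mul_rpow ha hρ, Gamma_add_one ha.ne']
  field_simp

theorem integral_add_mul_rpow_mul_rpow_norm_sub_eq (α : ℝ) (ℓ : E →L[ℝ] ℝ) (ha : 0 < a)
    (hn : (finrank ℝ E : ℝ) = 2 * a + 2) (x : E) :
    ∫ y : E, (α + ℓ y) * ((1 + ‖y‖ ^ 2) ^ (-(a + 3)) * (‖x - y‖ ^ 2) ^ (-a)) =
      π ^ (a + 1) / ((a + 2) * Gamma (a + 2)) *
        (α * (1 + ‖x‖ ^ 2) ^ (-a) * (a + 1)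
          + (ℓ x - α * ‖x‖ ^ 2) * a * (1 + ‖x‖ ^ 2) ^ (-(a + 1))) := by
  have hρ : 0 < 1 + ‖x‖ ^ 2 := by positivity
  have hG := (Gamma_pos_of_pos ha).ne'
  have ha1 : a + 1 ≠ 0 := by positivity
  have ha2 : a + 2 ≠ 0 := by positivity
  rw [integral_add_mul_rpow_mul_rpow_norm_sub α ℓ ha (by linarith) (by linarith) x, hn,
    show a + 3 + a - (2 * a + 2) / 2 = a + 2 by ring,
    show a + 3 + a - (2 * a + 2) = 1 by ring, show (2 * a + 2) / 2 = a + 1 by ring]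
  have hσ : ∀ σ ∈ Ioi (0 : ℝ), σ ^ (a - 1) * ((α + σ / (1 + σ) * ℓ x) *
      (1 + σ) ^ (1 : ℝ) * (1 + (1 + ‖x‖ ^ 2) * σ) ^ (-(a + 2))) =
      α * (σ ^ (a - 1) * (1 + (1 + ‖x‖ ^ 2) * σ) ^ (-(a + 1))) +
        (ℓ x - α * ‖x‖ ^ 2) *
          (σ ^ (a + 1 - 1) * (1 + (1 + ‖x‖ ^ 2) * σ) ^ (-(a + 1 + 1))) := fun σ hσ ↦ by
    have hσ0 : (0 : ℝ) < σ := hσ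
    have hm : 0 < 1 + (1 + ‖x‖ ^ 2) * σ := by positivity
    rw [rpow_one, show -(a + 1) = -(a + 2) + 1 by ring, rpow_add_one hm.ne',
      show a + 1 - 1 = (a - 1) + 1 by ring, rpow_add_one hσ0.ne', show a + 1 + 1 = a + 2 by ring]
    field_simp
    ring
  rw [setIntegral_congr_fun measurableSet_Ioi hσ, integral_add
    ((integrableOn_rpow_mul_one_add_mul_rpow ha hρ).const_mul _)
    ((integrableOn_rpow_mul_one_add_mul_rpow (by positivity) hρ).const_mul _),
    integral_const_mul, integral_const_mul, integral_rpow_mul_one_add_mul_rpow ha hρ,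
    integral_rpow_mul_one_add_mul_rpow (by positivity) hρ, show a + 3 = a + 2 + 1 by ring,
    Gamma_add_one ha2, show a + 2 = a + 1 + 1 by ring, Gamma_add_one ha1, Gamma_add_one ha.ne']
  have ha2' : a + 1 + 1 ≠ 0 := by positivity
  field_simp

end NewtonianPotential

theorem stmt13 (N : ℕ) (hN : 3 ≤ N) :
    (∀ x : EuclideanSpace ℝ (Fin N),
        ((N : ℝ) - 2) / 2 * (‖x‖ ^ 2 - 1) * (1 + ‖x‖ ^ 2) ^ (-((N : ℝ) / 2))
          = ((N : ℝ) + 2) /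
              (((N : ℝ) - 2) * (2 * π ^ ((N : ℝ) / 2) / ((N : ℝ) * Gamma ((N : ℝ) / 2)))) *
            ∫ y : EuclideanSpace ℝ (Fin N),
              (1 + ‖y‖ ^ 2) ^ (-(2 : ℝ)) *
                  (((N : ℝ) - 2) / 2 * (‖y‖ ^ 2 - 1) * (1 + ‖y‖ ^ 2) ^ (-((N : ℝ) / 2))) *
                ‖x - y‖ ^ (-((N : ℝ) - 2))) ∧
    (∀ j : Fin N, ∀ x : EuclideanSpace ℝ (Fin N),
        ((N : ℝ) - 2) * x j * (1 + ‖x‖ ^ 2) ^ (-((N : ℝ) / 2))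
          = ((N : ℝ) + 2) /
              (((N : ℝ) - 2) * (2 * π ^ ((N : ℝ) / 2) / ((N : ℝ) * Gamma ((N : ℝ) / 2)))) *
            ∫ y : EuclideanSpace ℝ (Fin N),
              (1 + ‖y‖ ^ 2) ^ (-(2 : ℝ)) *
                  (((N : ℝ) - 2) * y j * (1 + ‖y‖ ^ 2) ^ (-((N : ℝ) / 2))) *
                ‖x - y‖ ^ (-((N : ℝ) - 2))) := by
  obtain ⟨a, hNa⟩ : ∃ a : ℝ, (N : ℝ) = 2 * a + 2 := ⟨N / 2 - 1, by ring⟩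
  have ha : 0 < a := by
    have : (3 : ℝ) ≤ N := by exact_mod_cast hN
    linarith
  have hn : (finrank ℝ (EuclideanSpace ℝ (Fin N)) : ℝ) = 2 * a + 2 := by
    rw [finrank_euclideanSpace_fin, hNa]
  have ha1 : a + 1 ≠ 0 := by positivity
  have hG1 := (Gamma_pos_of_pos (by positivity : 0 < a + 1)).ne'
  have hπ := (rpow_pos_of_pos pi_pos (a + 1)).ne'
  have hG : Gamma (a + 2) = (a + 1) * Gamma (a + 1) := by
    rw [show a + 2 = a + 1 + 1 by ring, Gamma_add_one ha1]
  have hnorm : ∀ z : EuclideanSpace ℝ (Fin N), ‖z‖ ^ (-(2 * a)) = (‖z‖ ^ 2) ^ (-a) := by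
    intro z
    rw [← rpow_natCast, ← rpow_mul (norm_nonneg z)]
    congr 1
    push_cast
    ring
  have hpow : ∀ y : EuclideanSpace ℝ (Fin N), (1 + ‖y‖ ^ 2) ^ (-(2 : ℝ)) *
      (1 + ‖y‖ ^ 2) ^ (-(a + 1)) = (1 + ‖y‖ ^ 2) ^ (-(a + 3)) := fun y ↦ by
    rw [← rpow_add (by positivity)]
    congr 1
    ring
  have hsucc : ∀ (y : EuclideanSpace ℝ (Fin N)) (b : ℝ), (1 + ‖y‖ ^ 2) ^ (-b) =
      (1 + ‖y‖ ^ 2) * (1 + ‖y‖ ^ 2) ^ (-(b + 1)) := fun y b ↦ by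
    rw [mul_comm, ← rpow_add_one (by positivity)]
    congr 1
    ring
  rw [hNa, show (2 * a + 2) / 2 = a + 1 by ring]
  simp only [add_sub_cancel_right, hnorm]
  refine ⟨fun x ↦ ?_, fun j x ↦ ?_⟩
  · have h1 := integral_rpow_mul_rpow_norm_sub ha hn x
    have h2 := integral_add_mul_rpow_mul_rpow_norm_sub_eq 1 0 ha hn x
    have i1 := integrable_add_mul_rpow_mul_rpow_norm_sub 1 0 (s := a + 2) ha (by linarith)
      (by linarith) x
    have i2 := integrable_add_mul_rpow_mul_rpow_norm_sub 1 0 (s := a + 3) ha (by linarith)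
      (by linarith) x
    simp only [_root_.zero_apply, add_zero, one_mul] at h2 i1 i2
    have hy : ∀ y : EuclideanSpace ℝ (Fin N), (1 + ‖y‖ ^ 2) ^ (-(2 : ℝ)) *
        ((2 * a) / 2 * (‖y‖ ^ 2 - 1) * (1 + ‖y‖ ^ 2) ^ (-(a + 1))) *
          (‖x - y‖ ^ 2) ^ (-a) = a * ((1 + ‖y‖ ^ 2) ^ (-(a + 2)) * (‖x - y‖ ^ 2) ^ (-a)
            - 2 * ((1 + ‖y‖ ^ 2) ^ (-(a + 3)) * (‖x - y‖ ^ 2) ^ (-a))) := fun y ↦ by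
      rw [hsucc y (a + 2), show a + 2 + 1 = a + 3 by ring, ← hpow]
      ring
    simp only [hy]
    rw [integral_const_mul, integral_sub i1 (i2.const_mul 2), integral_const_mul, h1, h2, hG,
      hsucc x a]
    field_simp
    ring
  · have h2 := integral_add_mul_rpow_mul_rpow_norm_sub_eq 0
      (EuclideanSpace.proj j : EuclideanSpace ℝ (Fin N) →L[ℝ] ℝ) ha hn x
    simp only [show ∀ y, (EuclideanSpace.proj j : EuclideanSpace ℝ (Fin N) →L[ℝ] ℝ) y = y j from
      fun _ ↦ rfl, zero_add, zero_mul, sub_zero] at h2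
    have hy : ∀ y : EuclideanSpace ℝ (Fin N), (1 + ‖y‖ ^ 2) ^ (-(2 : ℝ)) *
        ((2 * a) * y j * (1 + ‖y‖ ^ 2) ^ (-(a + 1))) * (‖x - y‖ ^ 2) ^ (-a) =
          2 * a * (y j * ((1 + ‖y‖ ^ 2) ^ (-(a + 3)) * (‖x - y‖ ^ 2) ^ (-a))) := fun y ↦ by
      rw [← hpow]
      ring
    simp only [hy]
    rw [integral_const_mul, h2, hG]
    field_simp
    ring
end

section
/- Let N ≥ 3 and let φ be continuous on ℝ^N with ‖φ‖_X = sup_x (1+|x|²)^{(N−2)/2}|φ(x)| < ∞. Let 0 < λ < N with λ ≤ 4 and p = (2N−λ)/(N−2). Then there is C = C(N,λ) such that for all x ∈ ℝ^N, |∫_{ℝ^N} U(y)^{p−1}φ(y)|x−y|^{−λ} dy| · U(x)^{p−1} + |∫_{ℝ^N} U(y)^p |x−y|^{−λ} dy| · U(x)^{p−2}|φ(x)| ≤ C‖φ‖_X (1+|x|²)^{−(N+2)/2}. -/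
open MeasureTheory Real

lemma integrable_indicator_ball_norm_rpow_neg {E : Type*} [NormedAddCommGroup E]
    [NormedSpace ℝ E] [FiniteDimensional ℝ E] [Nontrivial E] [MeasurableSpace E] [BorelSpace E]
    (μ : Measure E) [μ.IsAddHaarMeasure] {a : ℝ} (ha : a < Module.finrank ℝ E) :
    Integrable (fun z : E => (Set.Iio (1 : ℝ)).indicator (fun t => t ^ (-a)) ‖z‖) μ := by
  rw [integrable_fun_norm_addHaar]
  have h1 : IntegrableOn (fun t : ℝ => t ^ ((Module.finrank ℝ E : ℝ) - 1 - a)) (Set.Ioo 0 1) :=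
    (intervalIntegral.integrableOn_Ioo_rpow_iff one_pos).2 (by linarith)
  have h2 : IntegrableOn (fun t : ℝ => t ^ (Module.finrank ℝ E - 1) •
      (Set.Iio (1 : ℝ)).indicator (fun t => t ^ (-a)) t) (Set.Ioo 0 1) := by
    refine h1.congr_fun (fun t ht => ?_) measurableSet_Ioo
    have hn : 1 ≤ Module.finrank ℝ E := Module.finrank_pos
    simp only [Set.indicator_of_mem (show t ∈ Set.Iio (1 : ℝ) from ht.2), smul_eq_mul]
    rw [← rpow_natCast, ← rpow_add ht.1]
    push_cast [hn]
    ring_nf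
  refine h2.of_forall_sdiff_eq_zero measurableSet_Ioi (fun t ht => ?_)
  have : t ∉ Set.Iio (1 : ℝ) := fun h => ht.2 ⟨ht.1, h⟩
  simp [Set.indicator_of_notMem this]

lemma rpow_mul_rpow_neg_mul_rpow_neg_le {n a s A b : ℝ} (ha : 0 < a) (han : a < n)
    (hs : 0 < s) (hA : 1 ≤ A) (hb : 0 ≤ b) (hsAb : s ≤ 2 * A + 2 * b ^ 2) :
    s ^ (a / 2) * (A ^ (-((2 * n - a) / 2)) * b ^ (-a)) ≤
      4 ^ (a / 2) * (2 ^ ((2 * n - a) / 2) *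
        (A ^ (-((2 * n - a) / 2)) + (1 + b ^ 2) ^ (-((2 * n - a) / 2)) +
          (Set.Iio (1 : ℝ)).indicator (fun t => t ^ (-a)) b)) := by
  have hA0 : 0 < A := by linarith
  have hI : 0 ≤ (Set.Iio (1 : ℝ)).indicator (fun t => t ^ (-a)) b := by
    unfold Set.indicator
    split_ifs
    · exact rpow_nonneg hb _
    · exact le_rfl
  have h2 : (1 : ℝ) ≤ 2 ^ ((2 * n - a) / 2) := one_le_rpow (by norm_num) (by linarith)
  have hAq : 0 ≤ A ^ (-((2 * n - a) / 2)) := by positivity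
  have hBq : 0 ≤ (1 + b ^ 2) ^ (-((2 * n - a) / 2)) := by positivity
  rcases hb.eq_or_lt with rfl | hb0
  · rw [zero_rpow (by linarith), mul_zero, mul_zero]
    positivity
  rcases le_or_gt A (b ^ 2) with hAb | hAb
  · have hle : s ^ (a / 2) ≤ 4 ^ (a / 2) * b ^ a := by
      calc s ^ (a / 2) ≤ (4 * b ^ 2) ^ (a / 2) :=
            rpow_le_rpow hs.le (by linarith) (by linarith)
        _ = 4 ^ (a / 2) * b ^ a := by
            rw [mul_rpow (by norm_num) (by positivity), ← rpow_natCast b 2, ← rpow_mul hb]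
            congr 2
            push_cast
            ring
    calc s ^ (a / 2) * (A ^ (-((2 * n - a) / 2)) * b ^ (-a))
        ≤ (4 ^ (a / 2) * b ^ a) * (A ^ (-((2 * n - a) / 2)) * b ^ (-a)) := by gcongr
      _ = 4 ^ (a / 2) * (A ^ (-((2 * n - a) / 2)) * (b ^ a * b ^ (-a))) := by ring
      _ = 4 ^ (a / 2) * A ^ (-((2 * n - a) / 2)) := by
          rw [← rpow_add hb0, add_neg_cancel, rpow_zero, mul_one]
      _ ≤ _ := by
          gcongr
          nlinarith
  · have hle : s ^ (a / 2) ≤ 4 ^ (a / 2) * A ^ (a / 2) := by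
      rw [← mul_rpow (by norm_num) hA0.le]
      exact rpow_le_rpow hs.le (by linarith) (by linarith)
    have hmain : s ^ (a / 2) * (A ^ (-((2 * n - a) / 2)) * b ^ (-a)) ≤
        4 ^ (a / 2) * (A ^ (-(n - a)) * b ^ (-a)) := by
      calc s ^ (a / 2) * (A ^ (-((2 * n - a) / 2)) * b ^ (-a))
          ≤ (4 ^ (a / 2) * A ^ (a / 2)) * (A ^ (-((2 * n - a) / 2)) * b ^ (-a)) := by gcongr
        _ = 4 ^ (a / 2) * ((A ^ (a / 2) * A ^ (-((2 * n - a) / 2))) * b ^ (-a)) := by ring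
        _ = _ := by
            rw [← rpow_add hA0]
            congr 3
            ring_nf
    refine hmain.trans (mul_le_mul_of_nonneg_left ?_ (by positivity))
    rcases lt_or_ge b 1 with hb1 | hb1
    · rw [Set.indicator_of_mem (show b ∈ Set.Iio (1 : ℝ) from hb1)]
      have h1 : A ^ (-(n - a)) ≤ 1 := rpow_le_one_of_one_le_of_nonpos hA (by linarith)
      have hbp : 0 ≤ b ^ (-a) := rpow_nonneg hb _
      nlinarith
    · have h1 : A ^ (-(n - a)) ≤ (b ^ 2) ^ (-(n - a)) :=
        rpow_le_rpow_of_nonpos (by positivity) hAb.le (by linarith)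
      have h3 : (b ^ 2) ^ (-(n - a)) * b ^ (-a) = (b ^ 2) ^ (-((2 * n - a) / 2)) := by
        rw [← rpow_natCast b 2, ← rpow_mul hb, ← rpow_mul hb, ← rpow_add hb0]
        congr 1
        push_cast
        ring
      have h4 : (b ^ 2) ^ (-((2 * n - a) / 2)) ≤
          2 ^ ((2 * n - a) / 2) * (1 + b ^ 2) ^ (-((2 * n - a) / 2)) := by
        calc (b ^ 2) ^ (-((2 * n - a) / 2))
            = 2 ^ ((2 * n - a) / 2) * (2 * b ^ 2) ^ (-((2 * n - a) / 2)) := by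
              rw [mul_rpow (by norm_num) (by positivity), ← mul_assoc,
                ← rpow_add (by norm_num), add_neg_cancel, rpow_zero, one_mul]
          _ ≤ _ := by
              gcongr 2 ^ ((2 * n - a) / 2) * ?_
              exact rpow_le_rpow_of_nonpos (by positivity) (by nlinarith) (by linarith)
      calc A ^ (-(n - a)) * b ^ (-a) ≤ (b ^ 2) ^ (-(n - a)) * b ^ (-a) := by gcongr
        _ ≤ 2 ^ ((2 * n - a) / 2) * (1 + b ^ 2) ^ (-((2 * n - a) / 2)) := h3.trans_le h4
        _ ≤ _ := by
            gcongr
            linarith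

lemma exists_abs_integral_le_of_abs_le_rpow {N : ℕ} (hN : 0 < N) {a : ℝ} (ha : 0 < a)
    (haN : a < N) :
    ∃ C > 0, ∀ (f : EuclideanSpace ℝ (Fin N) → ℝ) (M : ℝ), 0 ≤ M →
      (∀ y, |f y| ≤ M * (1 + ‖y‖ ^ 2) ^ (-((2 * (N : ℝ) - a) / 2))) →
      ∀ x, |∫ y, f y * ‖x - y‖ ^ (-a)| ≤ C * M * (1 + ‖x‖ ^ 2) ^ (-(a / 2)) := by
  have : Nonempty (Fin N) := ⟨⟨0, hN⟩⟩
  have hdim : Module.finrank ℝ (EuclideanSpace ℝ (Fin N)) = N := by simp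
  set q : ℝ := (2 * (N : ℝ) - a) / 2 with hq
  set g : EuclideanSpace ℝ (Fin N) → ℝ := fun y => (1 + ‖y‖ ^ 2) ^ (-q) with hg
  set k : EuclideanSpace ℝ (Fin N) → ℝ :=
    fun z => (Set.Iio (1 : ℝ)).indicator (fun t => t ^ (-a)) ‖z‖
  have hgi : Integrable g := by
    have := integrable_rpow_neg_one_add_norm_sq (E := EuclideanSpace ℝ (Fin N))
      (μ := volume) (r := 2 * (N : ℝ) - a) (by rw [hdim]; linarith)
    simpa only [hg, hq, neg_div] using this
  have hki : Integrable k := integrable_indicator_ball_norm_rpow_neg volume (by rwa [hdim])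
  have hg0 : ∀ y, 0 ≤ g y := fun y => by positivity
  have hk0 : ∀ y, 0 ≤ k y := fun y => Set.indicator_apply_nonneg fun _ => by positivity
  set I : ℝ := (∫ y, g y) + (∫ y, g y) + ∫ y, k y
  have hI0 : 0 ≤ I := by
    have h1 : 0 ≤ ∫ y, g y := integral_nonneg hg0
    have h2 : 0 ≤ ∫ y, k y := integral_nonneg hk0
    positivity
  refine ⟨4 ^ (a / 2) * 2 ^ q * (I + 1), by positivity, fun f M hM hf x => ?_⟩
  set s : ℝ := 1 + ‖x‖ ^ 2
  have hs0 : 0 < s := by positivity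
  have hgx : Integrable (fun y => g (x - y)) := hgi.comp_sub_left x
  have hkx : Integrable (fun y => k (x - y)) := hki.comp_sub_left x
  have hint : Integrable (fun y => M * s ^ (-(a / 2)) * (4 ^ (a / 2) * 2 ^ q) *
      (g y + g (x - y) + k (x - y))) := ((hgi.add hgx).add hkx).const_mul _
  have hpt : ∀ y, ‖f y * ‖x - y‖ ^ (-a)‖ ≤ M * s ^ (-(a / 2)) * (4 ^ (a / 2) * 2 ^ q) *
      (g y + g (x - y) + k (x - y)) := by
    intro y
    have hb : s ≤ 2 * (1 + ‖y‖ ^ 2) + 2 * ‖x - y‖ ^ 2 := by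
      have h1 : ‖x‖ ≤ ‖y‖ + ‖x - y‖ := by
        simpa using norm_add_le y (x - y)
      have h2 : ‖x‖ ^ 2 ≤ (‖y‖ + ‖x - y‖) ^ 2 := by gcongr
      nlinarith [sq_nonneg (‖y‖ - ‖x - y‖)]
    have hkey := rpow_mul_rpow_neg_mul_rpow_neg_le ha haN hs0
      (show 1 ≤ 1 + ‖y‖ ^ 2 by nlinarith [sq_nonneg ‖y‖]) (norm_nonneg (x - y)) hb
    rw [norm_mul, Real.norm_eq_abs, Real.norm_of_nonneg (by positivity : 0 ≤ ‖x - y‖ ^ (-a))]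
    have hss : s ^ (-(a / 2)) * s ^ (a / 2) = 1 := by
      rw [← rpow_add hs0, neg_add_cancel, rpow_zero]
    calc |f y| * ‖x - y‖ ^ (-a) ≤ M * g y * ‖x - y‖ ^ (-a) := by
          gcongr
          exact hf y
      _ = M * (s ^ (-(a / 2)) * s ^ (a / 2)) * (g y * ‖x - y‖ ^ (-a)) := by rw [hss]; ring
      _ = M * s ^ (-(a / 2)) * (s ^ (a / 2) * (g y * ‖x - y‖ ^ (-a))) := by ring
      _ ≤ M * s ^ (-(a / 2)) * (4 ^ (a / 2) * (2 ^ q * (g y + g (x - y) + k (x - y)))) := by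
          gcongr
      _ = _ := by ring
  have hle := norm_integral_le_of_norm_le hint (Filter.Eventually.of_forall hpt)
  have hsum : ∫ y, (g y + g (x - y) + k (x - y)) = I := by
    rw [integral_add (f := fun y => g y + g (x - y)) (hgi.add hgx) hkx,
      integral_add hgi hgx, integral_sub_left_eq_self g volume x,
      integral_sub_left_eq_self k volume x]
  rw [Real.norm_eq_abs, integral_const_mul, hsum] at hle
  refine hle.trans ?_
  have : 0 ≤ M * s ^ (-(a / 2)) * (4 ^ (a / 2) * 2 ^ q) := by positivity
  nlinarith

theorem stmt18 (N : ℕ) (hN : 3 ≤ N) (lam : ℝ) (h0 : 0 < lam) (hlt : lam < N)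
    (h4 : lam ≤ 4) :
    ∃ C > 0, ∀ φ : EuclideanSpace ℝ (Fin N) → ℝ, Continuous φ →
      ∀ M : ℝ, (∀ x, (1 + ‖x‖ ^ 2) ^ (((N : ℝ) - 2) / 2) * |φ x| ≤ M) →
        ∀ x : EuclideanSpace ℝ (Fin N),
          |∫ y : EuclideanSpace ℝ (Fin N),
              ((1 + ‖y‖ ^ 2) ^ (-(((N : ℝ) - 2) / 2)))
                  ^ ((2 * (N : ℝ) - lam) / ((N : ℝ) - 2) - 1) * φ y *
                ‖x - y‖ ^ (-lam)| *
              ((1 + ‖x‖ ^ 2) ^ (-(((N : ℝ) - 2) / 2)))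
                  ^ ((2 * (N : ℝ) - lam) / ((N : ℝ) - 2) - 1)
            + |∫ y : EuclideanSpace ℝ (Fin N),
                ((1 + ‖y‖ ^ 2) ^ (-(((N : ℝ) - 2) / 2)))
                    ^ ((2 * (N : ℝ) - lam) / ((N : ℝ) - 2)) * ‖x - y‖ ^ (-lam)| *
              ((1 + ‖x‖ ^ 2) ^ (-(((N : ℝ) - 2) / 2)))
                  ^ ((2 * (N : ℝ) - lam) / ((N : ℝ) - 2) - 2) * |φ x|
            ≤ C * M * (1 + ‖x‖ ^ 2) ^ (-(((N : ℝ) + 2) / 2)) := by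
  have hN3 : (3 : ℝ) ≤ N := by exact_mod_cast hN
  have hN2 : (N : ℝ) - 2 ≠ 0 := by linarith
  obtain ⟨C, hC, hbound⟩ := exists_abs_integral_le_of_abs_le_rpow (by lia : 0 < N) h0 hlt
  refine ⟨2 * C, by positivity, fun φ _ M hM x => ?_⟩
  have hM0 : 0 ≤ M := le_trans (by positivity) (hM 0)
  have hpow : ∀ (y : EuclideanSpace ℝ (Fin N)) (c : ℝ),
      ((1 + ‖y‖ ^ 2) ^ (-(((N : ℝ) - 2) / 2))) ^ ((2 * (N : ℝ) - lam) / ((N : ℝ) - 2) - c) =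
        (1 + ‖y‖ ^ 2) ^ (-((2 * (N : ℝ) - lam) / 2) + c * (((N : ℝ) - 2) / 2)) := by
    intro y c
    rw [← rpow_mul (by positivity)]
    congr 1
    field_simp
    ring
  have hpow0 : ∀ y : EuclideanSpace ℝ (Fin N),
      ((1 + ‖y‖ ^ 2) ^ (-(((N : ℝ) - 2) / 2))) ^ ((2 * (N : ℝ) - lam) / ((N : ℝ) - 2)) =
        (1 + ‖y‖ ^ 2) ^ (-((2 * (N : ℝ) - lam) / 2)) := by
    intro y
    simpa using hpow y 0
  have hφ : ∀ y, |φ y| ≤ M * (1 + ‖y‖ ^ 2) ^ (-(((N : ℝ) - 2) / 2)) := by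
    intro y
    rw [rpow_neg (by positivity), ← div_eq_mul_inv, le_div_iff₀ (by positivity), mul_comm]
    exact hM y
  simp only [hpow, hpow0]
  have hX : 0 < 1 + ‖x‖ ^ 2 := by positivity
  have h1 := hbound (fun y => (1 + ‖y‖ ^ 2) ^ (-((2 * (N : ℝ) - lam) / 2) +
      1 * (((N : ℝ) - 2) / 2)) * φ y) M hM0 (fun y => by
    rw [abs_mul, abs_of_nonneg (by positivity)]
    calc _ ≤ (1 + ‖y‖ ^ 2) ^ (-((2 * (N : ℝ) - lam) / 2) + 1 * (((N : ℝ) - 2) / 2)) *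
          (M * (1 + ‖y‖ ^ 2) ^ (-(((N : ℝ) - 2) / 2))) := by
          gcongr
          exact hφ y
      _ = _ := by
          rw [mul_left_comm, ← rpow_add (by positivity)]
          ring_nf) x
  have h2 := hbound (fun y => (1 + ‖y‖ ^ 2) ^ (-((2 * (N : ℝ) - lam) / 2))) 1 zero_le_one
    (fun y => by rw [abs_of_nonneg (by positivity), one_mul]) x
  have e1 : (1 + ‖x‖ ^ 2) ^ (-(lam / 2)) *
      (1 + ‖x‖ ^ 2) ^ (-((2 * (N : ℝ) - lam) / 2) + 1 * (((N : ℝ) - 2) / 2)) =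
      (1 + ‖x‖ ^ 2) ^ (-(((N : ℝ) + 2) / 2)) := by
    rw [← rpow_add hX]
    ring_nf
  have e2 : (1 + ‖x‖ ^ 2) ^ (-(lam / 2)) *
      (1 + ‖x‖ ^ 2) ^ (-((2 * (N : ℝ) - lam) / 2) + 2 * (((N : ℝ) - 2) / 2)) *
      (1 + ‖x‖ ^ 2) ^ (-(((N : ℝ) - 2) / 2)) =
      (1 + ‖x‖ ^ 2) ^ (-(((N : ℝ) + 2) / 2)) := by
    rw [← rpow_add hX, ← rpow_add hX]
    ring_nf
  calc _ ≤ C * M * (1 + ‖x‖ ^ 2) ^ (-(lam / 2)) *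
        (1 + ‖x‖ ^ 2) ^ (-((2 * (N : ℝ) - lam) / 2) + 1 * (((N : ℝ) - 2) / 2)) +
        C * 1 * (1 + ‖x‖ ^ 2) ^ (-(lam / 2)) *
        (1 + ‖x‖ ^ 2) ^ (-((2 * (N : ℝ) - lam) / 2) + 2 * (((N : ℝ) - 2) / 2)) *
        (M * (1 + ‖x‖ ^ 2) ^ (-(((N : ℝ) - 2) / 2))) := by
        gcongr
        exact hφ x
    _ = 2 * C * M * (1 + ‖x‖ ^ 2) ^ (-(((N : ℝ) + 2) / 2)) := by
        linear_combination C * M * e1 + C * M * e2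
end
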